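/- Let n ≥ 3, let 0 ≤ q ≤ 1 − 1/√(n−1), and let p ∈ ℝ satisfy p + q − 1 < (2−q)²/((1−q)(n−2)). Then every positive classical solution u of Δu + |∇u|^q u^p = 0 on all of ℝ^n is constant. -/

import Mathlib

open scoped BigOperators

/-- The Euclidean Laplacian of `u : ℝⁿ → ℝ`, defined as the sum of the second
partial derivatives in the coordinate directions. -/
noncomputable def elaplacian {n : ℕ} (u : EuclideanSpace ℝ (Fin n) → ℝ)
    (x : EuclideanSpace ℝ (Fin n)) : ℝ :=
  ∑ i : Fin n, fderiv ℝ (fun y => fderiv ℝ u y (EuclideanSpace.single i 1)) x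
    (EuclideanSpace.single i 1)

section Auxiliary

open MeasureTheory Filter Topology Set

/-- The partial derivative in the `i`-th coordinate direction. -/
noncomputable def partialD {n : ℕ} (i : Fin n) (f : EuclideanSpace ℝ (Fin n) → ℝ)
    (x : EuclideanSpace ℝ (Fin n)) : ℝ :=
  fderiv ℝ f x (EuclideanSpace.single i 1)

section Calculus

variable {n : ℕ} {f g v : EuclideanSpace ℝ (Fin n) → ℝ}

theorem ContDiff.partialD {k m : WithTop ℕ∞} (hf : ContDiff ℝ k f) (hmk : m + 1 ≤ k) (i : Fin n) :
    ContDiff ℝ m (partialD i f) :=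
  (hf.fderiv_right hmk).clm_apply contDiff_const

theorem ContDiff.continuous_partialD (hf : ContDiff ℝ 1 f) (i : Fin n) :
    Continuous (_root_.partialD i f) :=
  (hf.partialD (m := 0) (by norm_num) i).continuous

theorem HasCompactSupport.partialD (hf : HasCompactSupport f) (i : Fin n) :
    HasCompactSupport (partialD i f) :=
  hf.fderiv_apply ℝ _

theorem partialD_mul {x : EuclideanSpace ℝ (Fin n)} (hf : DifferentiableAt ℝ f x)
    (hg : DifferentiableAt ℝ g x) (i : Fin n) :
    partialD i (fun y => f y * g y) x = partialD i f x * g x + f x * partialD i g x := by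
  simp only [partialD]
  rw [fderiv_fun_mul hf hg]
  simp
  ring

theorem partialD_comp {x : EuclideanSpace ℝ (Fin n)} {h : ℝ → ℝ} {h' : ℝ}
    (hh : HasDerivAt h h' (f x)) (hf : DifferentiableAt ℝ f x) (i : Fin n) :
    partialD i (fun y => h (f y)) x = h' * partialD i f x := by
  simp only [partialD]
  have := (hh.comp_hasFDerivAt x hf.hasFDerivAt).fderiv
  simp only [Function.comp_def] at this
  rw [this]
  simp

theorem partialD_comm (hv : ContDiff ℝ 2 v) (i j : Fin n) (x : EuclideanSpace ℝ (Fin n)) :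
    partialD i (partialD j v) x = partialD j (partialD i v) x := by
  have hs : IsSymmSndFDerivAt ℝ v x := hv.contDiffAt.isSymmSndFDerivAt (by simp)
  have hd : DifferentiableAt ℝ (fderiv ℝ v) x :=
    (hv.fderiv_right (m := 1) (by norm_num)).differentiable (by norm_num) x
  have key : ∀ i j : Fin n, partialD i (partialD j v) x =
      fderiv ℝ (fderiv ℝ v) x (EuclideanSpace.single i 1) (EuclideanSpace.single j 1) := by
    intro i j
    simp only [partialD]
    have : (_root_.partialD j v) = fun y => fderiv ℝ v y (EuclideanSpace.single j 1) := rfl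
    rw [this, fderiv_clm_apply hd (differentiableAt_const _)]
    simp
  rw [key, key]
  exact hs _ _

theorem integral_partialD_eq_zero (hf : ContDiff ℝ 1 f) (hc : HasCompactSupport f) (i : Fin n) :
    ∫ x, partialD i f x = 0 := by
  have hI : Integrable (fun x => fderiv ℝ f x (EuclideanSpace.single i 1)) volume :=
    (hf.continuous_partialD i).integrable_of_hasCompactSupport (hc.partialD i)
  have h := integral_mul_fderiv_eq_neg_fderiv_mul_of_integrable (μ := volume)
    (f := fun _ : EuclideanSpace ℝ (Fin n) => (1 : ℝ)) (g := f) (v := EuclideanSpace.single i 1)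
    (by simp)
    (by simpa using hI)
    (by simpa using hf.continuous.integrable_of_hasCompactSupport hc)
    (fun _ _ => by fun_prop) (fun _ _ => hf.differentiable (by norm_num) _)
  simpa [partialD] using h

theorem integral_partialD_mul (hf : ContDiff ℝ 1 f) (hg : ContDiff ℝ 1 g)
    (hc : HasCompactSupport f) (i : Fin n) :
    ∫ x, partialD i f x * g x = - ∫ x, f x * partialD i g x := by
  have h := integral_partialD_eq_zero (hf.mul hg) (hc.mul_right) i
  have e : (fun x => partialD i (fun y => f y * g y) x) =
      fun x => partialD i f x * g x + f x * partialD i g x := by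
    funext x
    exact partialD_mul (hf.differentiable (by norm_num) x) (hg.differentiable (by norm_num) x) i
  rw [e, integral_add] at h
  · linarith
  · exact ((hf.continuous_partialD i).mul hg.continuous).integrable_of_hasCompactSupport
      ((hc.partialD i).mul_right)
  · exact (hf.continuous.mul (hg.continuous_partialD i)).integrable_of_hasCompactSupport
      (hc.mul_right)

theorem hasDerivAt_integral_translate (hf : ContDiff ℝ 1 f) (hg : Continuous g)
    (hfc : HasCompactSupport f) (hgc : HasCompactSupport g) (i : Fin n) :
    HasDerivAt (fun t : ℝ => ∫ x, f (x + t • EuclideanSpace.single i 1) * g x)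
      (∫ x, partialD i f x * g x) 0 := by
  obtain ⟨C, hC⟩ := (hf.continuous_partialD i).bounded_above_of_compact_support (hfc.partialD i)
  have h_int : ∀ t : ℝ, Continuous (fun x => f (x + t • EuclideanSpace.single i 1) * g x) := by
    intro t
    exact (hf.continuous.comp (by fun_prop)).mul hg
  have h := hasDerivAt_integral_of_dominated_loc_of_deriv_le (μ := volume) (𝕜 := ℝ)
    (F := fun t x => f (x + t • EuclideanSpace.single i 1) * g x)
    (F' := fun t x => partialD i f (x + t • EuclideanSpace.single i 1) * g x)
    (x₀ := 0) (s := univ) (bound := fun x => C * ‖g x‖) univ_mem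
    (Eventually.of_forall fun t => (h_int t).aestronglyMeasurable)
    ((h_int 0).integrable_of_hasCompactSupport hgc.mul_left)
    (by
      apply Continuous.aestronglyMeasurable
      exact ((hf.continuous_partialD i).comp (by fun_prop)).mul hg)
    (Eventually.of_forall fun x t _ => by
      rw [norm_mul]
      exact mul_le_mul_of_nonneg_right (hC _) (norm_nonneg _))
    ((hg.norm.integrable_of_hasCompactSupport hgc.norm).const_mul C)
    (Eventually.of_forall fun x t _ => by
      apply HasDerivAt.mul_const
      have h1 : HasDerivAt (fun t : ℝ => x + t • (EuclideanSpace.single i 1 :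
          EuclideanSpace ℝ (Fin n))) (EuclideanSpace.single i 1) t := by
        have := ((hasDerivAt_id t).smul_const (EuclideanSpace.single i 1 :
          EuclideanSpace ℝ (Fin n))).const_add x
        simpa using this
      exact ((hf.differentiable (by norm_num) _).hasFDerivAt.comp_hasDerivAt t h1))
  simpa using h.2

theorem integral_partialD_mul_partialD_comm_of_compact (hf : ContDiff ℝ 1 f) (hg : ContDiff ℝ 1 g)
    (hfc : HasCompactSupport f) (hgc : HasCompactSupport g) (i j : Fin n) :
    ∫ x, partialD i f x * partialD j g x = ∫ x, partialD j f x * partialD i g x := by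
  have h1 := hasDerivAt_integral_translate hf (hg.continuous_partialD j) hfc (hgc.partialD j) i
  have h2 := hasDerivAt_integral_translate hg (hf.continuous_partialD j) hgc (hfc.partialD j) i
  have e : ∀ t : ℝ, ∫ x, f (x + t • EuclideanSpace.single i 1) * partialD j g x =
      - ∫ x, g (x + (-t) • EuclideanSpace.single i 1) * partialD j f x := by
    intro t
    have hf' : ContDiff ℝ 1 (fun x => f (x + t • EuclideanSpace.single i 1)) :=
      hf.comp (by fun_prop)
    have hcomm : ∫ x, f (x + t • EuclideanSpace.single i 1) * partialD j g x =
        - ∫ x, partialD j (fun x => f (x + t • EuclideanSpace.single i 1)) x * g x := by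
      have := integral_partialD_mul hg hf' hgc j
      simp only [mul_comm (partialD j g _), mul_comm (g _)] at this
      exact this
    rw [hcomm, ← integral_add_right_eq_self _ ((-t) • EuclideanSpace.single i 1)]
    congr 1
    apply integral_congr_ae
    refine Eventually.of_forall fun x => ?_
    simp only [partialD]
    rw [fderiv_comp_add_right]
    simp [mul_comm]
  have h3 : HasDerivAt (fun t : ℝ => ∫ x, f (x + t • EuclideanSpace.single i 1) * partialD j g x)
      (∫ x, partialD i g x * partialD j f x) 0 := by
    have h4 := (h2.comp_of_eq (0 : ℝ) (hasDerivAt_neg (0 : ℝ)) (by simp)).neg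
    have : (fun t : ℝ => ∫ x, f (x + t • EuclideanSpace.single i 1) * partialD j g x) =
      (-(fun t : ℝ => ∫ x, g (x + t • EuclideanSpace.single i 1) * partialD j f x) ∘ Neg.neg) := by
      funext t
      rw [e t]
      simp
    rw [this]
    simpa using h4
  rw [h1.unique h3]
  simp [mul_comm]

theorem integral_partialD_mul_partialD_comm (hf : ContDiff ℝ 1 f) (hg : ContDiff ℝ 1 g)
    (hfc : HasCompactSupport f) (i j : Fin n) :
    ∫ x, partialD i f x * partialD j g x = ∫ x, partialD j f x * partialD i g x := by
  obtain ⟨R, hR⟩ := hfc.isBounded.subset_ball (0 : EuclideanSpace ℝ (Fin n))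
  let χ : ContDiffBump (0 : EuclideanSpace ℝ (Fin n)) :=
    ⟨max R 1, max R 1 + 1, by positivity, by linarith⟩
  have hχ : ContDiff ℝ 1 (fun x => χ x * g x) := χ.contDiff.mul hg
  have h := integral_partialD_mul_partialD_comm_of_compact hf hχ hfc
    (χ.hasCompactSupport.mul_right) i j
  have key : ∀ i j x, partialD i f x * partialD j (fun x => χ x * g x) x =
      partialD i f x * partialD j g x := by
    intro i j x
    by_cases hx : x ∈ tsupport f
    · congr 1
      simp only [partialD]
      have : (fun x => χ x * g x) =ᶠ[𝓝 x] g := by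
        filter_upwards [χ.eventuallyEq_one_of_mem_ball
          (Metric.ball_subset_ball (le_max_left R 1) (hR hx))] with y hy
        simp [hy]
      rw [this.fderiv_eq]
    · have : partialD i f x = 0 := by
        have : f =ᶠ[𝓝 x] fun _ => 0 := notMem_tsupport_iff_eventuallyEq.mp hx
        simp only [partialD, this.fderiv_eq]
        simp
      simp [this]
  simpa only [key] using h

end Calculus

section Bochner

variable {n : ℕ} {v : EuclideanSpace ℝ (Fin n) → ℝ}

theorem elaplacian_eq_sum (v : EuclideanSpace ℝ (Fin n) → ℝ) (x : EuclideanSpace ℝ (Fin n)) :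
    elaplacian v x = ∑ i, partialD i (partialD i v) x := rfl

/-- The Hessian of `v` applied to the gradient of `v`. -/
noncomputable def hessGrad (v : EuclideanSpace ℝ (Fin n) → ℝ) (j : Fin n)
    (x : EuclideanSpace ℝ (Fin n)) : ℝ :=
  ∑ i, partialD i v x * partialD j (partialD i v) x

/-- The squared Hilbert–Schmidt norm of the Hessian of `v`. -/
noncomputable def hessSq (v : EuclideanSpace ℝ (Fin n) → ℝ) (x : EuclideanSpace ℝ (Fin n)) : ℝ :=
  ∑ i, ∑ j, partialD j (partialD i v) x ^ 2

/-- The integrated Bochner formula for `C²` functions. -/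
theorem integral_bochner (hv : ContDiff ℝ 2 v) {φ χ : EuclideanSpace ℝ (Fin n) → ℝ}
    (hφ : ContDiff ℝ 1 φ) (hφc : HasCompactSupport φ) (hχ : ContDiff ℝ 1 χ)
    (hχc : HasCompactSupport χ) (he : ∀ x, χ x = φ x * elaplacian v x) :
    Integrable (fun x => ∑ j, partialD j φ x * hessGrad v j x + φ x * hessSq v x +
      (∑ i, partialD i χ x * partialD i v x -
        elaplacian v x * ∑ i, partialD i φ x * partialD i v x)) ∧
    ∫ x, (∑ j, partialD j φ x * hessGrad v j x + φ x * hessSq v x +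
      (∑ i, partialD i χ x * partialD i v x -
        elaplacian v x * ∑ i, partialD i φ x * partialD i v x)) = 0 := by
  have ha : ∀ i, ContDiff ℝ 1 (partialD i v) := fun i => hv.partialD (by norm_num) i
  have had : ∀ i x, DifferentiableAt ℝ (partialD i v) x :=
    fun i => (ha i).differentiable (by norm_num)
  have hφd := hφ.differentiable (by norm_num)
  have hχd := hχ.differentiable (by norm_num)
  have hφa : ∀ i, ContDiff ℝ 1 (fun y => φ y * partialD i v y) := fun i => hφ.mul (ha i)
  have hφac : ∀ i, HasCompactSupport (fun y => φ y * partialD i v y) := fun i => hφc.mul_right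
  have hχa : ∀ i, ContDiff ℝ 1 (fun y => χ y * partialD i v y) := fun i => hχ.mul (ha i)
  have hχac : ∀ i, HasCompactSupport (fun y => χ y * partialD i v y) := fun i => hχc.mul_right
  have e : (fun x => ∑ j, partialD j φ x * hessGrad v j x + φ x * hessSq v x +
      (∑ i, partialD i χ x * partialD i v x -
        elaplacian v x * ∑ i, partialD i φ x * partialD i v x)) =
      fun x => ∑ i, ((∑ j, (partialD j (fun y => φ y * partialD i v y) x *
          partialD i (partialD j v) x -
        partialD i (fun y => φ y * partialD i v y) x * partialD j (partialD j v) x)) +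
        partialD i (fun y => χ y * partialD i v y) x) := by
    funext x
    simp only [fun i j => partialD_mul (hφd x) (had i x) j,
      fun i j => partialD_mul (hχd x) (had i x) j, he x]
    simp only [Finset.sum_add_distrib, Finset.sum_sub_distrib, ← Finset.mul_sum,
      ← elaplacian_eq_sum]
    have h1 : ∑ j, partialD j φ x * hessGrad v j x + φ x * hessSq v x =
        ∑ i, ∑ j, (partialD j φ x * partialD i v x + φ x * partialD j (partialD i v) x) *
          partialD i (partialD j v) x := by
      simp only [hessGrad, hessSq, Finset.mul_sum]
      rw [Finset.sum_comm, ← Finset.sum_add_distrib]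
      refine Finset.sum_congr rfl fun i _ => ?_
      rw [← Finset.sum_add_distrib]
      refine Finset.sum_congr rfl fun j _ => ?_
      rw [partialD_comm hv i j]
      ring
    rw [h1]
    simp only [← Finset.sum_mul, Finset.sum_add_distrib, ← Finset.mul_sum, ← elaplacian_eq_sum]
    ring
  have hi1 : ∀ i j, Integrable (fun x => partialD j (fun y => φ y * partialD i v y) x *
      partialD i (partialD j v) x) := fun i j =>
    (((hφa i).continuous_partialD j).mul ((ha j).continuous_partialD i)
      ).integrable_of_hasCompactSupport (((hφac i).partialD j).mul_right)
  have hi2 : ∀ i j, Integrable (fun x => partialD i (fun y => φ y * partialD i v y) x *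
      partialD j (partialD j v) x) := fun i j =>
    (((hφa i).continuous_partialD i).mul ((ha j).continuous_partialD j)
      ).integrable_of_hasCompactSupport (((hφac i).partialD i).mul_right)
  have hi3 : ∀ i, Integrable (fun x => partialD i (fun y => χ y * partialD i v y) x) := fun i =>
    ((hχa i).continuous_partialD i).integrable_of_hasCompactSupport ((hχac i).partialD i)
  have hi6 : ∀ i j, Integrable (fun x => partialD j (fun y => φ y * partialD i v y) x *
          partialD i (partialD j v) x -
        partialD i (fun y => φ y * partialD i v y) x * partialD j (partialD j v) x) := fun i j =>
    (hi1 i j).sub (hi2 i j)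
  have hi4 : ∀ i, Integrable (fun x => ∑ j, (partialD j (fun y => φ y * partialD i v y) x *
          partialD i (partialD j v) x -
        partialD i (fun y => φ y * partialD i v y) x * partialD j (partialD j v) x)) := fun i =>
    integrable_finsetSum _ fun j _ => hi6 i j
  have hi5 : ∀ i, Integrable (fun x => ∑ j, (partialD j (fun y => φ y * partialD i v y) x *
          partialD i (partialD j v) x -
        partialD i (fun y => φ y * partialD i v y) x * partialD j (partialD j v) x) +
        partialD i (fun y => χ y * partialD i v y) x) := fun i => (hi4 i).add (hi3 i)
  rw [e]
  refine ⟨integrable_finsetSum _ fun i _ => hi5 i, ?_⟩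
  rw [integral_finsetSum _ fun i _ => hi5 i]
  refine Finset.sum_eq_zero fun i _ => ?_
  rw [integral_add (hi4 i) (hi3 i), integral_partialD_eq_zero (hχa i) (hχac i), add_zero,
    integral_finsetSum _ fun j _ => hi6 i j]
  refine Finset.sum_eq_zero fun j _ => ?_
  rw [integral_sub (hi1 i j) (hi2 i j),
    integral_partialD_mul_partialD_comm (hφa i) (ha j) (hφac i) j i, sub_self]

/-- The divergence theorem for a compactly supported multiple of a gradient. -/
theorem integral_div_mul_grad (hv : ContDiff ℝ 2 v) {ζ : EuclideanSpace ℝ (Fin n) → ℝ}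
    (hζ : ContDiff ℝ 1 ζ) (hζc : HasCompactSupport ζ) :
    Integrable (fun x => ∑ i, partialD i ζ x * partialD i v x + ζ x * elaplacian v x) ∧
    ∫ x, (∑ i, partialD i ζ x * partialD i v x + ζ x * elaplacian v x) = 0 := by
  have ha : ∀ i, ContDiff ℝ 1 (partialD i v) := fun i => hv.partialD (by norm_num) i
  have hζa : ∀ i, ContDiff ℝ 1 (fun y => ζ y * partialD i v y) := fun i => hζ.mul (ha i)
  have hζac : ∀ i, HasCompactSupport (fun y => ζ y * partialD i v y) := fun i => hζc.mul_right
  have e : (fun x => ∑ i, partialD i ζ x * partialD i v x + ζ x * elaplacian v x) =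
      fun x => ∑ i, partialD i (fun y => ζ y * partialD i v y) x := by
    funext x
    rw [elaplacian_eq_sum, Finset.mul_sum, ← Finset.sum_add_distrib]
    refine Finset.sum_congr rfl fun i _ => ?_
    rw [partialD_mul (hζ.differentiable (by norm_num) x) ((ha i).differentiable (by norm_num) x)]
  have hi : ∀ i, Integrable (fun x => partialD i (fun y => ζ y * partialD i v y) x) := fun i =>
    ((hζa i).continuous_partialD i).integrable_of_hasCompactSupport ((hζac i).partialD i)
  rw [e]
  refine ⟨integrable_finsetSum _ fun i _ => hi i, ?_⟩
  rw [integral_finsetSum _ fun i _ => hi i]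
  exact Finset.sum_eq_zero fun i _ => integral_partialD_eq_zero (hζa i) (hζac i) i

theorem gradient_apply_eq_partialD (v : EuclideanSpace ℝ (Fin n) → ℝ)
    (x : EuclideanSpace ℝ (Fin n)) (i : Fin n) : gradient v x i = partialD i v x := by
  have h : inner ℝ (gradient v x) (EuclideanSpace.single i (1 : ℝ)) =
      fderiv ℝ v x (EuclideanSpace.single i 1) := by
    rw [← toDual_gradient, InnerProductSpace.toDual_apply_apply]
  rw [partialD, ← h, EuclideanSpace.inner_single_right]
  simp

theorem norm_gradient_sq (v : EuclideanSpace ℝ (Fin n) → ℝ) (x : EuclideanSpace ℝ (Fin n)) :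
    ‖gradient v x‖ ^ 2 = ∑ i, partialD i v x ^ 2 := by
  rw [EuclideanSpace.norm_sq_eq]
  simp [gradient_apply_eq_partialD]

theorem ContDiff.gradient (hv : ContDiff ℝ 2 v) : ContDiff ℝ 1 (gradient v) := by
  have h : ContDiff ℝ 1 (fderiv ℝ v) := hv.fderiv_right (by norm_num)
  exact (InnerProductSpace.toDual ℝ (EuclideanSpace ℝ (Fin n))).symm.contDiff.comp h

theorem partialD_norm_gradient (hv : ContDiff ℝ 2 v) {x : EuclideanSpace ℝ (Fin n)}
    (hx : gradient v x ≠ 0) :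
    DifferentiableAt ℝ (fun y => ‖gradient v y‖) x ∧
    ∀ j, partialD j (fun y => ‖gradient v y‖) x = hessGrad v j x / ‖gradient v x‖ := by
  have hd : DifferentiableAt ℝ (fun y => ‖gradient v y‖) x :=
    (hv.gradient.differentiable (by norm_num) x).norm ℝ hx
  refine ⟨hd, fun j => ?_⟩
  have h1 := partialD_comp (h := fun s => s ^ 2) (hasDerivAt_pow 2 _) hd j
  have h2 : partialD j (fun y => ‖gradient v y‖ ^ 2) x = 2 * hessGrad v j x := by
    simp only [norm_gradient_sq]
    have had : ∀ i, DifferentiableAt ℝ (partialD i v) x := fun i =>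
      (hv.partialD (m := 1) (by norm_num) i).differentiable (by norm_num) x
    have had2 : ∀ i, DifferentiableAt ℝ (fun y => partialD i v y ^ 2) x := fun i => (had i).pow 2
    rw [partialD, fderiv_fun_sum fun i _ => had2 i]
    simp only [hessGrad, Finset.mul_sum, sum_apply]
    refine Finset.sum_congr rfl fun i _ => ?_
    have := partialD_comp (f := partialD i v) (h := fun s => s ^ 2) (hasDerivAt_pow 2 _) (had i) j
    rw [partialD] at this
    rw [this]
    push_cast
    ring
  rw [h2] at h1
  have : ‖gradient v x‖ ≠ 0 := norm_ne_zero_iff.mpr hx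
  field_simp
  simp at h1
  linarith

theorem partialD_eq_zero_of_nonneg {f : EuclideanSpace ℝ (Fin n) → ℝ} (hf : ∀ x, 0 ≤ f x)
    {x : EuclideanSpace ℝ (Fin n)} (hx : f x = 0) (i : Fin n) : partialD i f x = 0 := by
  have : IsLocalMin f x := Eventually.of_forall fun y => by rw [hx]; exact hf y
  rw [partialD, this.fderiv_eq_zero]
  simp

end Bochner

section Weighted

variable {n : ℕ} {v w : EuclideanSpace ℝ (Fin n) → ℝ} {x : EuclideanSpace ℝ (Fin n)}

theorem partialD_weight (hv : ContDiff ℝ 2 v) (hvx : 0 < v x) (hS : gradient v x ≠ 0)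
    (hw : DifferentiableAt ℝ w x) {g : ℝ → ℝ} {g' : ℝ} (hg : HasDerivAt g g' ‖gradient v x‖)
    (a : ℝ) (i : Fin n) :
    partialD i (fun y => w y * (v y ^ a * g ‖gradient v y‖)) x =
      partialD i w x * (v x ^ a * g ‖gradient v x‖) +
        w x * (a * (v x ^ a / v x) * partialD i v x * g ‖gradient v x‖ +
          v x ^ a * (g' * (hessGrad v i x / ‖gradient v x‖))) := by
  obtain ⟨hSd, hSi⟩ := partialD_norm_gradient hv hS
  have hvd : DifferentiableAt ℝ v x := hv.differentiable (by norm_num) x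
  have h1 : DifferentiableAt ℝ (fun y => g ‖gradient v y‖) x :=
    (hg.comp_hasFDerivAt x hSd.hasFDerivAt).differentiableAt
  have hr : HasDerivAt (fun s : ℝ => s ^ a) (a * v x ^ (a - 1)) (v x) :=
    Real.hasDerivAt_rpow_const (Or.inl hvx.ne')
  have h2 : DifferentiableAt ℝ (fun y => v y ^ a) x :=
    (hr.comp_hasFDerivAt x hvd.hasFDerivAt).differentiableAt
  have h3 : DifferentiableAt ℝ (fun y => v y ^ a * g ‖gradient v y‖) x := h2.mul h1
  rw [partialD_mul hw h3, partialD_mul h2 h1, partialD_comp (f := fun y => ‖gradient v y‖) hg hSd,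
    partialD_comp hr hvd,
    hSi, Real.rpow_sub_one hvx.ne']

theorem sum_hessGrad_mul_le (v : EuclideanSpace ℝ (Fin n) → ℝ) (x : EuclideanSpace ℝ (Fin n)) :
    (∑ i, partialD i v x * hessGrad v i x) ^ 2 ≤
      (∑ i, partialD i v x ^ 2) * ∑ i, hessGrad v i x ^ 2 :=
  Finset.sum_mul_sq_le_sq_mul_sq _ _ _

/-- Lower bound for the Hessian norm with the gradient directions split off. -/
theorem hessSq_lower_bound (hv : ContDiff ℝ 2 v) (hn : 2 ≤ n)
    (hS : gradient v x ≠ 0) {P Q : ℝ} (hP : P = ∑ i, partialD i v x ^ 2)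
    (hQ : Q = ∑ i, partialD i v x * hessGrad v i x) :
    2 * (∑ i, hessGrad v i x ^ 2) / P - Q ^ 2 / P ^ 2 +
      (elaplacian v x - Q / P) ^ 2 / ((n : ℝ) - 1) ≤ hessSq v x := by
  have hP0 : 0 < P := by
    rw [hP, ← norm_gradient_sq]
    have := norm_pos_iff.mpr hS
    positivity
  have hN : (0 : ℝ) < (n : ℝ) - 1 := by
    have : (2 : ℝ) ≤ n := by exact_mod_cast hn
    linarith
  set a : Fin n → ℝ := fun i => partialD i v x with ha
  set b : Fin n → ℝ := fun i => hessGrad v i x with hb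
  set h : Fin n → Fin n → ℝ := fun i j => partialD j (partialD i v) x with hh
  have hsym : ∀ i j, h i j = h j i := fun i j => partialD_comm hv j i x
  have hbj : ∀ j, ∑ i, a i * h i j = b j := fun j => rfl
  have hbi : ∀ i, ∑ j, h i j * a j = b i := fun i => by
    rw [← hbj]
    exact Finset.sum_congr rfl fun j _ => by rw [hsym i j]; ring
  have htr : ∑ i, h i i = elaplacian v x := rfl
  have haa : ∑ i, a i * a i = P := by rw [hP]; exact Finset.sum_congr rfl fun i _ => by ring
  have hab : ∑ i, a i * b i = Q := hQ.symm
  set t : ℝ := (elaplacian v x - Q / P) / ((n : ℝ) - 1) with ht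
  let δ : Fin n → Fin n → ℝ := fun i j => if i = j then 1 else 0
  let p : Fin n → Fin n → ℝ := fun i j =>
    h i j - (a i * b j + b i * a j) / P + (Q / P ^ 2 + t / P) * (a i * a j) - t * δ i j
  have hnn : 0 ≤ ∑ i, ∑ j, p i j ^ 2 :=
    Finset.sum_nonneg fun i _ => Finset.sum_nonneg fun j _ => sq_nonneg _
  have d1 : ∀ f : Fin n → Fin n → ℝ, ∑ i, ∑ j, δ i j * f i j = ∑ i, f i i := fun f => by
    refine Finset.sum_congr rfl fun i _ => ?_
    simp [δ]
  have hs1 : ∑ i, ∑ j, h i j * (a i * b j) = ∑ i, b i ^ 2 := by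
    rw [Finset.sum_comm]
    refine Finset.sum_congr rfl fun j _ => ?_
    rw [sq]
    nth_rewrite 2 [← hbj j]
    rw [Finset.sum_mul]
    exact Finset.sum_congr rfl fun i _ => by ring
  have hs2 : ∑ i, ∑ j, h i j * (b i * a j) = ∑ i, b i ^ 2 := by
    refine Finset.sum_congr rfl fun i _ => ?_
    rw [sq]
    nth_rewrite 2 [← hbi i]
    rw [Finset.sum_mul]
    exact Finset.sum_congr rfl fun j _ => by ring
  have hs3 : ∑ i, ∑ j, h i j * (a i * a j) = Q := by
    rw [← hab]
    refine Finset.sum_congr rfl fun i _ => ?_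
    rw [← hbi i, Finset.mul_sum]
    exact Finset.sum_congr rfl fun j _ => by ring
  have prod : ∀ f g : Fin n → ℝ, ∑ i, ∑ j, f i * g j = (∑ i, f i) * ∑ j, g j := fun f g => by
    rw [Finset.sum_mul_sum]
  have hs4 : ∑ i, ∑ j, (a i * a i) * (b j * b j) = P * ∑ i, b i ^ 2 := by
    rw [prod, haa]; congr 1; exact Finset.sum_congr rfl fun i _ => by ring
  have hs5 : ∑ i, ∑ j, (b i * b i) * (a j * a j) = P * ∑ i, b i ^ 2 := by
    rw [prod, haa, mul_comm]; congr 1; exact Finset.sum_congr rfl fun i _ => by ring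
  have hs6 : ∑ i, ∑ j, (a i * b i) * (a j * b j) = Q ^ 2 := by
    rw [prod, hab]; ring
  have hs7 : ∑ i, ∑ j, (a i * a i) * (a j * b j) = P * Q := by rw [prod, haa, hab]
  have hs8 : ∑ i, ∑ j, (a i * b i) * (a j * a j) = Q * P := by rw [prod, haa, hab]
  have hs9 : ∑ i, ∑ j, (a i * a i) * (a j * a j) = P * P := by rw [prod, haa]
  have e1 := d1 h
  have e2 := d1 (fun i j => a i * b j)
  have e3 := d1 (fun i j => a i * a j)
  have e4 := d1 (fun _ _ => 1)
  simp only [hab, haa, htr, Finset.sum_const, Finset.card_univ, Fintype.card_fin, nsmul_eq_mul,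
    mul_one] at e1 e2 e3 e4
  have e2' := d1 (fun i j => b i * a j)
  have hba : ∑ i, b i * a i = Q := by
    rw [← hab]; exact Finset.sum_congr rfl fun i _ => by ring
  simp only [hba] at e2'
  have hδ : ∀ i j, δ i j * δ i j = δ i j := fun i j => by simp [δ]
  have key : ∀ i j, p i j ^ 2 = h i j ^ 2 - 2 / P * (h i j * (a i * b j)) -
      2 / P * (h i j * (b i * a j)) + 2 * (Q / P ^ 2 + t / P) * (h i j * (a i * a j)) -
      2 * t * (δ i j * h i j) + 1 / P ^ 2 * ((a i * a i) * (b j * b j)) +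
      1 / P ^ 2 * ((b i * b i) * (a j * a j)) + 2 / P ^ 2 * ((a i * b i) * (a j * b j)) -
      2 / P * (Q / P ^ 2 + t / P) * ((a i * a i) * (a j * b j)) -
      2 / P * (Q / P ^ 2 + t / P) * ((a i * b i) * (a j * a j)) +
      2 * t / P * (δ i j * (a i * b j)) + 2 * t / P * (δ i j * (b i * a j)) +
      (Q / P ^ 2 + t / P) ^ 2 * ((a i * a i) * (a j * a j)) -
      2 * (Q / P ^ 2 + t / P) * t * (δ i j * (a i * a j)) + t ^ 2 * δ i j := fun i j => by
    have := hδ i j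
    simp only [p]
    linear_combination t ^ 2 * this
  have pull : ∀ (c : ℝ) (f : Fin n → Fin n → ℝ),
      ∑ i, ∑ j, c * f i j = c * ∑ i, ∑ j, f i j := fun c f => by
    simp only [Finset.mul_sum]
  simp only [key, Finset.sum_add_distrib, Finset.sum_sub_distrib, pull, hs1, hs2, hs3,
    hs4, hs5, hs6, hs7, hs8, hs9, e1, e2, e2', e3, e4] at hnn
  have hhS : hessSq v x = ∑ i, ∑ j, h i j ^ 2 := rfl
  rw [hhS]
  have htN : elaplacian v x - Q / P = t * ((n : ℝ) - 1) := by
    rw [ht]; field_simp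
  have htN2 : elaplacian v x = t * ((n : ℝ) - 1) + Q / P := by linarith
  rw [htN2] at hnn
  rw [htN]
  change 2 * (∑ i, b i ^ 2) / P - _ + _ ≤ _
  refine le_of_sub_nonneg (hnn.trans_eq ?_)
  field_simp
  ring

end Weighted

section Pointwise

variable {n : ℕ} {v η : EuclideanSpace ℝ (Fin n) → ℝ} {x : EuclideanSpace ℝ (Fin n)}

theorem quadratic_form_lower_bound {N S y m ρ ξ φ ψ K c L bb Q hh : ℝ} (hS : 0 < S) (hy : 0 < y)
    (hm : 0 < m) (hρ : 0 ≤ ρ) (hK : 1 ≤ K) (hL : L = S ^ 2 * φ / y)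
    (hQ : Q ^ 2 ≤ S ^ 2 * bb)
    (hhh : 2 * bb / S ^ 2 - Q ^ 2 / (S ^ 2) ^ 2 + (L - Q / S ^ 2) ^ 2 / N ≤ hh)
    (hstar : ∀ β : ℝ, c * (1 + ξ) ^ 2 ≤ m * ((φ - β) ^ 2 / N - β ^ 2 + ψ * β - φ) + ρ * β ^ 2 -
      φ + 1 + (K - 1) * (m * β - 1) ^ 2) :
    c * (S * (1 + ξ) / y) ^ 2 + (m ^ 2 * bb / S ^ 4 - 2 * m * Q / (S ^ 2 * y) + S ^ 2 / y ^ 2) ≤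
      (K * m ^ 2 + ρ - 2 * m) * bb / S ^ 4 - 2 * K * m * Q / (S ^ 2 * y) + m * hh / S ^ 2 -
        m * φ * S ^ 2 / y ^ 2 + m * ψ * Q / (S ^ 2 * y) + (K + 1) * S ^ 2 / y ^ 2 -
        S ^ 2 * φ / y ^ 2 := by
  set β := Q * y / S ^ 4 with hβ
  have hQβ : Q = β * S ^ 4 / y := by rw [hβ]; field_simp
  set e := bb * y ^ 2 / S ^ 6 with he
  have hbe : bb = e * S ^ 6 / y ^ 2 := by rw [he]; field_simp
  have heβ : β ^ 2 ≤ e := by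
    rw [hβ, he, div_pow, mul_pow, div_le_div_iff₀ (by positivity) (by positivity)]
    have : 0 ≤ y ^ 2 * S ^ 6 := by positivity
    calc Q ^ 2 * y ^ 2 * S ^ 6 = Q ^ 2 * (y ^ 2 * S ^ 6) := by ring
      _ ≤ S ^ 2 * bb * (y ^ 2 * S ^ 6) := by gcongr
      _ = _ := by ring
  have h1 : m * (S ^ 4 / y ^ 2 * (2 * e - β ^ 2 + (φ - β) ^ 2 / N)) / S ^ 2 ≤ m * hh / S ^ 2 := by
    gcongr
    refine le_trans (le_of_eq ?_) hhh
    rw [hL, hQβ, hbe]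
    field_simp
  have h2 := hstar β
  have h3 : 0 ≤ S ^ 2 / y ^ 2 := by positivity
  have h4 : 0 ≤ (K - 1) * m ^ 2 * (e - β ^ 2) :=
    mul_nonneg (mul_nonneg (by linarith) (by positivity)) (by linarith)
  have h5 : 0 ≤ ρ * (e - β ^ 2) := mul_nonneg hρ (by linarith)
  have h6 := mul_nonneg h3 (add_nonneg (add_nonneg h4 h5) (sub_nonneg.mpr h2))
  refine le_trans ?_ (add_le_add_left (add_le_add_left (add_le_add_left (add_le_add_left
    (add_le_add_right h1 _) _) _) _) _)
  refine le_of_sub_nonneg (h6.trans_eq ?_)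
  rw [hQβ, hbe]
  field_simp
  ring

/-- The pointwise inequality behind the weighted Bochner method. -/
theorem bochner_integrand_lower_bound (hv : ContDiff ℝ 2 v) (hn : 2 ≤ n) (hvx : 0 < v x)
    (hη : DifferentiableAt ℝ η x) (hη0 : 0 ≤ η x) (e : ℕ) {S m ρ ξ φ ψ K c J : ℝ}
    (hS : 0 < S) (hSx : ‖gradient v x‖ = S) (hm : 0 < m) (hρ : 0 ≤ ρ) (hK : 1 ≤ K) (hJ : 0 ≤ J)
    (hL : elaplacian v x = S ^ 2 * φ / v x)
    (hstar : ∀ β : ℝ, c * (1 + ξ) ^ 2 ≤ m * ((φ - β) ^ 2 / ((n : ℝ) - 1) - β ^ 2 + ψ * β - φ) +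
      ρ * β ^ 2 - φ + 1 + (K - 1) * (m * β - 1) ^ 2)
    {th ps jj : ℝ → ℝ} (hj0 : jj S = J) (ht0 : th S = J * m / S ^ 2) (hp0 : ps S = J * m * φ)
    (hj : HasDerivAt jj (K * m * J / S) S)
    (ht : HasDerivAt th (J * (K * m ^ 2 + ρ - 2 * m) / S ^ 3) S)
    (hp : HasDerivAt ps (ψ * J * m / S + φ * (J * (K * m ^ 2 + ρ - 2 * m)) / S) S) :
    v x ^ (-K) * J * (c * η x ^ (e + 2) * (S * (1 + ξ) / v x) ^ 2 -
      ((e : ℝ) + 2) ^ 2 / 4 * η x ^ e * ∑ i, partialD i η x ^ 2) ≤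
    (∑ j, partialD j (fun y => η y ^ (e + 2) * (v y ^ (-K) * th ‖gradient v y‖)) x *
        hessGrad v j x +
      η x ^ (e + 2) * (v x ^ (-K) * th ‖gradient v x‖) * hessSq v x +
      (∑ i, partialD i (fun y => η y ^ (e + 2) * (v y ^ (-K - 1) * ps ‖gradient v y‖)) x *
          partialD i v x -
        elaplacian v x * ∑ i, partialD i
          (fun y => η y ^ (e + 2) * (v y ^ (-K) * th ‖gradient v y‖)) x * partialD i v x)) -
    (∑ i, partialD i (fun y => η y ^ (e + 2) * (v y ^ (-K - 1) * jj ‖gradient v y‖)) x *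
        partialD i v x +
      η x ^ (e + 2) * (v x ^ (-K - 1) * jj ‖gradient v x‖) * elaplacian v x) := by
  have hg0 : gradient v x ≠ 0 := by
    rw [← norm_ne_zero_iff, hSx]; exact hS.ne'
  have hw : DifferentiableAt ℝ (fun y => η y ^ (e + 2)) x := hη.pow _
  have hwi : ∀ i, partialD i (fun y => η y ^ (e + 2)) x =
      ((e : ℝ) + 2) * η x ^ (e + 1) * partialD i η x := fun i => by
    rw [partialD_comp (h := fun s => s ^ (e + 2)) (hasDerivAt_pow (e + 2) _) hη]
    push_cast
    simp
  rw [← hSx] at hj ht hp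
  simp only [partialD_weight hv hvx hg0 hw hj, partialD_weight hv hvx hg0 hw ht,
    partialD_weight hv hvx hg0 hw hp, hwi, Real.rpow_sub_one hvx.ne', hSx, hj0, ht0, hp0, hL]
  set V := v x ^ (-K) with hV
  have hV0 : 0 < V := Real.rpow_pos_of_pos hvx _
  set y := v x with hy
  have hP : ∑ i, partialD i v x ^ 2 = S ^ 2 := by rw [← norm_gradient_sq, hSx]
  set Q := ∑ i, partialD i v x * hessGrad v i x with hQ
  set bb := ∑ i, hessGrad v i x ^ 2 with hbb
  set wb := ∑ i, partialD i η x * hessGrad v i x with hwb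
  set wa := ∑ i, partialD i η x * partialD i v x with hwa
  set gg := ∑ i, partialD i η x ^ 2 with hgg
  have hQb : Q ^ 2 ≤ S ^ 2 * bb := by rw [← hP]; exact sum_hessGrad_mul_le v x
  have hhess := hessSq_lower_bound hv hn hg0 hP.symm hQ
  have hquad := quadratic_form_lower_bound hS hvx hm hρ hK hL hQb hhess hstar
  have pull : ∀ (α β : ℝ) (a b c : Fin n → ℝ), ∑ i, (α * a i + β * b i) * c i =
      α * ∑ i, a i * c i + β * ∑ i, b i * c i := fun α β a b c => by
    simp only [add_mul, Finset.sum_add_distrib, Finset.mul_sum, mul_assoc]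
  have pull3 : ∀ (α β γ : ℝ) (a b d c : Fin n → ℝ), ∑ i, (α * a i + β * b i + γ * d i) * c i =
      α * ∑ i, a i * c i + β * ∑ i, b i * c i + γ * ∑ i, d i * c i := fun α β γ a b d c => by
    simp only [add_mul, Finset.sum_add_distrib, Finset.mul_sum, mul_assoc]
  have hcross : 0 ≤ η x ^ e * (η x ^ 2 * (m ^ 2 * bb / S ^ 4 - 2 * m * Q / (S ^ 2 * y) +
      S ^ 2 / y ^ 2) + (e + 2) * η x * (m / S ^ 2 * wb - wa / y) + (e + 2) ^ 2 / 4 * gg) := by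
    refine mul_nonneg (pow_nonneg hη0 _) ?_
    have : 0 ≤ ∑ i, (η x * (m / S ^ 2) * hessGrad v i x + (-η x / y) * partialD i v x +
        ((e : ℝ) + 2) / 2 * partialD i η x) ^ 2 := Finset.sum_nonneg fun i _ => sq_nonneg _
    refine this.trans_eq ?_
    have hex : ∀ i, (η x * (m / S ^ 2) * hessGrad v i x + (-η x / y) * partialD i v x +
        ((e : ℝ) + 2) / 2 * partialD i η x) ^ 2 =
        (η x * (m / S ^ 2)) ^ 2 * hessGrad v i x ^ 2 + (η x / y) ^ 2 * partialD i v x ^ 2 +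
        (((e : ℝ) + 2) / 2) ^ 2 * partialD i η x ^ 2 +
        (-2 * (η x) ^ 2 * m / (S ^ 2 * y)) * (partialD i v x * hessGrad v i x) +
        (η x * m / S ^ 2 * (e + 2)) * (partialD i η x * hessGrad v i x) +
        (-η x / y * (e + 2)) * (partialD i η x * partialD i v x) := fun i => by
      field_simp
      ring
    simp only [hex, Finset.sum_add_distrib, ← Finset.mul_sum, hP, ← hQ, ← hbb, ← hwb, ← hwa,
      ← hgg]
    field_simp
    ring
  have hab : ∑ i, hessGrad v i x * partialD i v x = Q := by
    rw [hQ]; exact Finset.sum_congr rfl fun i _ => by ring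
  have haa : ∑ i, partialD i v x * partialD i v x = S ^ 2 := by
    rw [← hP]; exact Finset.sum_congr rfl fun i _ => by ring
  have hbb' : ∑ i, hessGrad v i x * hessGrad v i x = bb := by
    rw [hbb]; exact Finset.sum_congr rfl fun i _ => by ring
  have form : ∀ (g g' α W : ℝ) (i : Fin n), ((e : ℝ) + 2) * η x ^ (e + 1) * partialD i η x *
      (W * g) + η x ^ (e + 2) * (α * (W / y) * partialD i v x * g +
        W * (g' * (hessGrad v i x / S))) =
      (((e : ℝ) + 2) * η x ^ (e + 1) * (W * g)) * partialD i η x +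
      (η x ^ (e + 2) * (α * (W / y) * g)) * partialD i v x +
      (η x ^ (e + 2) * (W * g' / S)) * hessGrad v i x := fun g g' α W i => by
    ring
  simp only [form, pull3, hab, haa, hbb', ← hQ, ← hwb, ← hwa]
  have hfin := add_nonneg (mul_nonneg (mul_nonneg hV0.le hJ) hcross)
    (mul_nonneg (mul_nonneg (mul_nonneg hV0.le hJ) (pow_nonneg hη0 (e + 2)))
      (sub_nonneg.mpr hquad))
  refine le_of_sub_nonneg (hfin.trans_eq ?_)
  have he1 : η x ^ (e + 1) = η x ^ e * η x := pow_succ _ _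
  have he2 : η x ^ (e + 2) = η x ^ e * η x ^ 2 := pow_add _ _ _
  rw [he1, he2]
  generalize η x ^ e = H
  field_simp
  ring

end Pointwise

section Parameters

theorem exists_coefficients {N s k : ℝ} (hN : 2 ≤ N) (hs : 0 < s)
    (hk : (N - 1) * s < k * (1 + s)) (hkN : k ≤ N - 1) :
    ∃ A B : ℝ, 0 < A ∧ A < 1 ∧ 0 < B ∧ B * (1 + N * s) < 1 ∧ (1 - A) * (N - 1) < k ∧
      0 < 2 * (1 - B) * (1 + k - A) - N + N * (B * (2 + k - A) + A * s * (B - 1)) := by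
  have hk0 : 0 < k := by
    by_contra h
    have : k * (1 + s) ≤ 0 := mul_nonpos_of_nonpos_of_nonneg (by linarith) (by linarith)
    have : 0 < (N - 1) * s := mul_pos (by linarith) hs
    linarith
  have hN1 : 0 < N - 1 := by linarith
  have hD : 0 < 1 + N * s := by positivity
  let A : ℝ → ℝ := fun t => 1 - k / (N - 1) + t
  let B : ℝ → ℝ := fun t => 1 / (1 + N * s) - t
  let T : ℝ → ℝ := fun t =>
    2 * (1 - B t) * (1 + k - A t) - N + N * (B t * (2 + k - A t) + A t * s * (B t - 1))
  have hA : Continuous A := by fun_prop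
  have hB : Continuous B := by fun_prop
  have hT : Continuous T := by fun_prop
  have hA0 : A 0 < 1 := by
    have : 0 < k / (N - 1) := by positivity
    simp only [A]; linarith
  have hB0 : 0 < B 0 := by simp only [B]; rw [sub_zero]; positivity
  have hT0 : 0 < T 0 := by
    have e : T 0 = N ^ 2 * (1 + s) * (k * (1 + s) - (N - 1) * s) / ((N - 1) * (1 + N * s)) := by
      simp only [T, A, B]
      field_simp
      ring
    rw [e]
    have : 0 < k * (1 + s) - (N - 1) * s := by linarith
    positivity
  have h1 : ∀ᶠ t in 𝓝[>] (0 : ℝ), A t < 1 :=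
    (hA.tendsto 0).eventually (gt_mem_nhds hA0) |>.filter_mono nhdsWithin_le_nhds
  have h2 : ∀ᶠ t in 𝓝[>] (0 : ℝ), 0 < B t :=
    (hB.tendsto 0).eventually (lt_mem_nhds hB0) |>.filter_mono nhdsWithin_le_nhds
  have h3 : ∀ᶠ t in 𝓝[>] (0 : ℝ), 0 < T t :=
    (hT.tendsto 0).eventually (lt_mem_nhds hT0) |>.filter_mono nhdsWithin_le_nhds
  have h4 : ∀ᶠ t in 𝓝[>] (0 : ℝ), 0 < t := self_mem_nhdsWithin
  obtain ⟨t, hA1, hB1, hT1, ht⟩ := (h1.and (h2.and (h3.and h4))).exists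
  refine ⟨A t, B t, ?_, hA1, hB1, ?_, ?_, hT1⟩
  · have : k / (N - 1) ≤ 1 := (div_le_one hN1).mpr hkN
    simp only [A]; linarith
  · have : B t * (1 + N * s) = 1 - t * (1 + N * s) := by simp only [B]; field_simp
    rw [this]
    have : 0 < t * (1 + N * s) := by positivity
    linarith
  · have : (1 - A t) * (N - 1) = k - t * (N - 1) := by simp only [A]; field_simp; ring
    rw [this]
    have : 0 < t * (N - 1) := by positivity
    linarith

theorem quadratic_bounded_below {a : ℝ} (ha : 0 < a) (b c : ℝ) :
    ∃ C : ℝ, 0 ≤ C ∧ ∀ ξ : ℝ, -C ≤ a * ξ ^ 2 + b * ξ + c := by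
  refine ⟨b ^ 2 / (4 * a) + |c|, by positivity, fun ξ => ?_⟩
  have h : 0 ≤ a * (ξ + b / (2 * a)) ^ 2 := by positivity
  have e : a * (ξ + b / (2 * a)) ^ 2 = a * ξ ^ 2 + b * ξ + b ^ 2 / (4 * a) := by
    field_simp; ring
  linarith [neg_abs_le c]

set_option maxHeartbeats 2000000 in
/-- The choice of parameters making the zeroth-order part of the Bochner integrand coercive. -/
theorem exists_coercive_parameters {N q k : ℝ} (hN : 2 ≤ N) (hq0 : 0 ≤ q) (hq1 : q < 1)
    (hNq : 1 ≤ N * (1 - q) ^ 2) (hk : (N - 1) * (1 - q) < k * (2 - q)) (hkN : k ≤ N - 1) :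
    ∃ A B ε c K₀ : ℝ, 0 < A ∧ A < 1 ∧ 0 < B ∧ 0 < ε ∧ 0 < c ∧ 0 ≤ K₀ ∧
      (1 - 1 / (ε + 1 / A)) * (N - 1) < k ∧
      ∀ ξ : ℝ, 0 < ξ → ∀ β : ℝ, c * (1 + ξ) ^ 2 ≤
        (ε + 1 / (A + B * ξ)) * ((1 + k + ξ - β) ^ 2 / N - β ^ 2 +
          (2 * (1 + k) + q * ξ) * β - (1 + k + ξ)) +
        (2 - q) * ξ * B / (A + B * ξ) ^ 2 * β ^ 2 - (1 + k + ξ) + 1 +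
        K₀ * ((ε + 1 / (A + B * ξ)) * β - 1) ^ 2 := by
  have hs : 0 < 1 - q := by linarith
  obtain ⟨A, B, hA, hA1, hB, hBD, hAk, hT1⟩ := exists_coefficients (s := 1 - q) hN hs
    (by linarith) hkN
  have hk0 : 0 < k := lt_of_le_of_lt (mul_nonneg (by linarith) (by linarith)) hAk
  have hN0 : 0 < N := by linarith
  have hNs : 0 < N * (1 - q) := by positivity
  have hB1 : B < 1 := by linarith [mul_pos hB hNs]
  have hg : 0 < 2 * (1 - B) / N - (1 - q) * B - (2 - q) * B ^ 2 := by
    set s := 1 - q with hs'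
    have hq : 2 - q = 1 + s := by rw [hs']; ring
    rw [hq]
    have e : 2 * (1 - B) / N - s * B - (1 + s) * B ^ 2 =
        (2 * (1 - B) - N * s * B - N * (1 + s) * B ^ 2) / N := by field_simp
    rw [e]
    apply div_pos _ hN0
    have hD : 0 < 1 + N * s := by positivity
    have h1 : 2 * (1 - B) - N * s * B - N * (1 + s) * B ^ 2 =
        (1 - B * (1 + N * s)) * (2 + N * s + N * (1 + s) * (1 / (1 + N * s)) +
          N * (1 + s) * B) / (1 + N * s) + N * (N * s ^ 2 - 1) / (1 + N * s) ^ 2 := by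
      field_simp
      ring
    rw [h1]
    have h2 : 0 < 1 - B * (1 + N * s) := by linarith
    have h3 : 0 ≤ N * s ^ 2 - 1 := by linarith
    positivity
  obtain ⟨C, hC, hU1⟩ := quadratic_bounded_below hg
    (2 * (2 * (1 + k) - A - B * (1 + k)) / N - 2 + q * A + B * (2 * (1 + k)) - A - B * k -
      (2 - q) * A * B) (2 * (1 + k) * (1 + k - A) / N + 2 * (1 + k) * A - 2 * (1 + k) - A * k)
  set T₀ := (1 - B) * (1 - B - N * (1 - q) * B) with hT₀
  have hT₀0 : 0 < T₀ := mul_pos (by linarith) (by linarith)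
  set T₂ := (1 + k - A) * (k - (1 - A) * (N - 1)) with hT₂
  have hT₂0 : 0 < T₂ := mul_pos (by linarith) (by linarith)
  set c₀ := min T₀ T₂ / N with hc₀
  have hc₀0 : 0 < c₀ := div_pos (lt_min hT₀0 hT₂0) hN0
  have hMlim : ∀ᶠ ε in 𝓝[>] (0 : ℝ), (1 - 1 / (ε + 1 / A)) * (N - 1) < k := by
    have hc : ContinuousAt (fun ε : ℝ => (1 - 1 / (ε + 1 / A)) * (N - 1)) 0 := by
      have : (0 : ℝ) + 1 / A ≠ 0 := by rw [zero_add]; positivity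
      fun_prop (disch := assumption)
    refine (hc.tendsto.eventually (gt_mem_nhds ?_)).filter_mono nhdsWithin_le_nhds
    simpa using hAk
  have hεlim : ∀ᶠ ε in 𝓝[>] (0 : ℝ), ε < min 1 (c₀ / (2 * C + N)) := by
    refine (gt_mem_nhds ?_ : ∀ᶠ ε in 𝓝 (0 : ℝ), _).filter_mono nhdsWithin_le_nhds
    exact lt_min one_pos (by positivity)
  obtain ⟨ε, ⟨hM, hεm⟩, hε⟩ := ((hMlim.and hεlim).and self_mem_nhdsWithin).exists
  have hε0 : 0 < ε := hε
  have hε1 : ε < 1 := hεm.trans_le (min_le_left _ _)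
  have hε2 : ε * (2 * C + N) ≤ c₀ := by
    have := (hεm.trans_le (min_le_right _ _)).le
    rwa [le_div_iff₀ (by positivity)] at this
  set a := min A B with ha
  have ha0 : 0 < a := lt_min hA hB
  set c := ε ^ 2 * a ^ 2 / (4 * N) with hc
  have hc0 : 0 < c := by positivity
  set C₁ := 4 * (1 + k) + 8 with hC₁
  have hC₁0 : 0 < C₁ := by positivity
  refine ⟨A, B, ε, c / 2, 1 / ε + C₁ ^ 2 / (2 * c), hA, hA1, hB, hε0, by positivity,
    by positivity, hM, fun ξ hξ β => ?_⟩
  set μ₀ := A + B * ξ with hμ₀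
  have hμ₀0 : 0 < μ₀ := by positivity
  have hμ₀1 : μ₀ ≤ 1 + ξ := by
    have : B * ξ ≤ 1 * ξ := by gcongr
    linarith
  have hμ₀a : a * (1 + ξ) ≤ μ₀ := by
    have h1 : a * ξ ≤ B * ξ := by gcongr; exact min_le_right _ _
    have h2 : a ≤ A := min_le_left _ _
    linarith
  set d := 1 + ε * μ₀ with hd
  have hd1 : 1 < d := by have := mul_pos hε0 hμ₀0; linarith
  have hd0 : 0 < d := by linarith
  have hd2 : d ≤ 2 * (1 + ξ) := by
    have : ε * μ₀ ≤ 1 * (1 + ξ) := by gcongr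
    linarith
  set φ := 1 + k + ξ with hφ
  have hφ1 : 1 + ξ ≤ φ := by linarith
  set U := (φ * d - μ₀) ^ 2 / N - μ₀ ^ 2 + (2 * (1 + k) + q * ξ) * μ₀ * d - φ * d ^ 2 +
    (2 - q) * ξ * B * μ₀ / d + μ₀ * d * (1 - φ) with hU
  have hUlow : 2 * c * (1 + ξ) ^ 4 ≤ U := by
    have hU0 : c₀ * (1 + ξ ^ 2) ≤ (φ - μ₀) ^ 2 / N - μ₀ ^ 2 + (2 * (1 + k) + q * ξ) * μ₀ - φ +
        (2 - q) * ξ * B * μ₀ + μ₀ * (1 - φ) := by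
      have e : (φ - μ₀) ^ 2 / N - μ₀ ^ 2 + (2 * (1 + k) + q * ξ) * μ₀ - φ +
        (2 - q) * ξ * B * μ₀ + μ₀ * (1 - φ) = (T₀ * ξ ^ 2 +
          (2 * (1 - B) * (1 + k - A) - N + N * (B * (2 + k - A) + A * (1 - q) * (B - 1))) * ξ +
          T₂) / N := by
        rw [hT₀, hT₂, hφ, hμ₀]
        field_simp
        ring
      rw [e, hc₀, div_mul_eq_mul_div]
      gcongr
      have h1 : min T₀ T₂ * ξ ^ 2 ≤ T₀ * ξ ^ 2 := by gcongr; exact min_le_left _ _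
      have h2 : min T₀ T₂ ≤ T₂ := min_le_right _ _
      have h3 := mul_pos hT1 hξ
      linarith
    have hU1' := hU1 ξ
    have hτ : ε * μ₀ * (-C) ≤ ε * μ₀ * (2 * φ * (φ - μ₀) / N + (2 * (1 + k) + q * ξ) * μ₀ -
        2 * φ - (2 - q) * ξ * B * μ₀ + μ₀ * (1 - φ)) := by
      gcongr
      refine hU1'.trans_eq ?_
      rw [hφ, hμ₀]
      field_simp
      ring
    have hτ2 : (ε * μ₀) ^ 2 * (φ ^ 2 / (2 * N) - N / 2) ≤ (ε * μ₀) ^ 2 * (φ ^ 2 / N - φ +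
        (2 - q) * ξ * B * μ₀ / d) := by
      gcongr
      have h1 : 0 ≤ (2 - q) * ξ * B * μ₀ / d := by
        have : 0 < 2 - q := by linarith
        positivity
      have h2 : 0 ≤ (φ - N) ^ 2 / (2 * N) := by positivity
      have h3 : (φ - N) ^ 2 / (2 * N) = φ ^ 2 / N - φ - (φ ^ 2 / (2 * N) - N / 2) := by
        field_simp; ring
      linarith
    have hUe : U = ((φ - μ₀) ^ 2 / N - μ₀ ^ 2 + (2 * (1 + k) + q * ξ) * μ₀ - φ +
        (2 - q) * ξ * B * μ₀ + μ₀ * (1 - φ)) + ε * μ₀ * (2 * φ * (φ - μ₀) / N +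
        (2 * (1 + k) + q * ξ) * μ₀ - 2 * φ - (2 - q) * ξ * B * μ₀ + μ₀ * (1 - φ)) +
        (ε * μ₀) ^ 2 * (φ ^ 2 / N - φ + (2 - q) * ξ * B * μ₀ / d) := by
      have hdi : 1 / d = 1 - ε * μ₀ + (ε * μ₀) ^ 2 / d := by
        rw [hd] at hd0 ⊢
        field_simp
        ring
      rw [hU, mul_div_assoc _ _ d, ← mul_one_div μ₀ d, hdi, hd]
      field_simp
      ring
    have h5 : ε ^ 2 * a ^ 2 / (2 * N) * (1 + ξ) ^ 4 ≤ (ε * μ₀) ^ 2 * (φ ^ 2 / (2 * N)) := by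
      have : (a * (1 + ξ)) ^ 2 * (1 + ξ) ^ 2 ≤ μ₀ ^ 2 * φ ^ 2 := by gcongr
      calc ε ^ 2 * a ^ 2 / (2 * N) * (1 + ξ) ^ 4 =
          ε ^ 2 / (2 * N) * ((a * (1 + ξ)) ^ 2 * (1 + ξ) ^ 2) := by ring
        _ ≤ ε ^ 2 / (2 * N) * (μ₀ ^ 2 * φ ^ 2) := by gcongr
        _ = _ := by ring
    have h6 : ε * μ₀ * C ≤ ε * (2 * C) * (1 + ξ ^ 2) := by
      have : μ₀ ≤ 2 * (1 + ξ ^ 2) := by linarith [sq_nonneg (ξ - 1), sq_nonneg ξ]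
      calc ε * μ₀ * C ≤ ε * (2 * (1 + ξ ^ 2)) * C := by gcongr
        _ = _ := by ring
    have h7 : (ε * μ₀) ^ 2 * (N / 2) ≤ ε * N * (1 + ξ ^ 2) := by
      have h8 : μ₀ ^ 2 ≤ 2 * (1 + ξ ^ 2) := by
        have : μ₀ ^ 2 ≤ (1 + ξ) ^ 2 := by gcongr
        linarith [sq_nonneg (ξ - 1)]
      have h9 : ε ^ 2 ≤ ε := pow_le_of_le_one hε0.le hε1.le two_ne_zero
      calc (ε * μ₀) ^ 2 * (N / 2) = ε ^ 2 * μ₀ ^ 2 * (N / 2) := by ring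
        _ ≤ ε * (2 * (1 + ξ ^ 2)) * (N / 2) := by gcongr
        _ = _ := by ring
    have h10 : ε * (2 * C + N) * (1 + ξ ^ 2) ≤ c₀ * (1 + ξ ^ 2) := by gcongr
    have h11 : 2 * c * (1 + ξ) ^ 4 = ε ^ 2 * a ^ 2 / (2 * N) * (1 + ξ) ^ 4 := by
      rw [hc]; ring
    rw [h11, hUe]
    linarith
  set δ := (ε + 1 / μ₀) * β - 1 with hδ
  have hm : ε + 1 / μ₀ = d / μ₀ := by rw [hd]; field_simp; ring
  have hβ : β = μ₀ / d * (1 + δ) := by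
    rw [hδ, hm]; field_simp; ring
  set μ := μ₀ / d with hμ
  have hμ0 : 0 < μ := by positivity
  have hμ1 : μ ≤ 1 + ξ := (div_le_self hμ₀0.le hd1.le).trans hμ₀1
  have hμε : μ ≤ 1 / ε := by
    rw [hμ, div_le_div_iff₀ hd0 hε0, hd]; linarith
  set r := (2 - q) * ξ * B / d ^ 2 with hr
  have hr0 : 0 ≤ r := by
    have : 0 < 2 - q := by linarith
    positivity
  have hr1 : r ≤ 2 * (1 + ξ) := by
    refine (div_le_self (by have : 0 < 2 - q := by linarith
                            positivity) (one_le_pow₀ hd1.le)).trans ?_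
    calc (2 - q) * ξ * B ≤ 2 * (1 + ξ) * 1 := by gcongr <;> linarith
      _ = _ := by ring
  set l₁ := -2 * (φ - μ) / N - 2 * μ + (2 * (1 + k) + q * ξ) + 2 * r with hl₁
  set l₂ := μ / N - μ + r with hl₂
  have hmain : (ε + 1 / μ₀) * ((φ - β) ^ 2 / N - β ^ 2 + (2 * (1 + k) + q * ξ) * β - φ) +
        (2 - q) * ξ * B / μ₀ ^ 2 * β ^ 2 - φ + 1 = U / (d * μ₀) + l₁ * δ + l₂ * δ ^ 2 := by
    rw [hm, hβ, hl₁, hl₂, hr, hU, hμ]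
    field_simp
    ring
  have hUd : c * (1 + ξ) ^ 2 ≤ U / (d * μ₀) := by
    rw [le_div_iff₀ (by positivity)]
    refine le_trans ?_ hUlow
    calc c * (1 + ξ) ^ 2 * (d * μ₀) ≤ c * (1 + ξ) ^ 2 * (2 * (1 + ξ) * (1 + ξ)) := by gcongr
      _ = _ := by ring
  have hl₁abs : |l₁| ≤ C₁ * (1 + ξ) := by
    have h1 : 0 ≤ φ / N := by positivity
    have h2 : φ / N ≤ (1 + k) * (1 + ξ) := by
      refine (div_le_self (by positivity) (by linarith)).trans ?_
      linarith [mul_pos hk0 hξ]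
    have h3 : 0 ≤ μ / N := by positivity
    have h4 : μ / N ≤ 1 + ξ := (div_le_self hμ0.le (by linarith)).trans hμ1
    have h5 : 0 ≤ q * ξ := by positivity
    have h6 : 2 * (1 + k) + q * ξ ≤ 2 * ((1 + k) * (1 + ξ)) := by
      have : q * ξ ≤ 1 * ξ := by gcongr
      linarith [mul_pos hk0 hξ]
    have h7 : l₁ = -2 * (φ / N) + 2 * (μ / N) - 2 * μ + (2 * (1 + k) + q * ξ) + 2 * r := by
      rw [hl₁]; ring
    rw [h7, hC₁, abs_le]
    constructor <;> linarith
  have hl₂low : -(1 / ε) ≤ l₂ := by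
    have : 0 ≤ μ / N := by positivity
    rw [hl₂]; linarith
  rw [hmain]
  have h1 : -(C₁ * (1 + ξ) * |δ|) ≤ l₁ * δ := by
    have h2 : |l₁ * δ| ≤ C₁ * (1 + ξ) * |δ| := by rw [abs_mul]; gcongr
    linarith [neg_abs_le (l₁ * δ)]
  have h2 : 0 ≤ (l₂ + 1 / ε) * δ ^ 2 := mul_nonneg (by linarith) (sq_nonneg _)
  have h3 : 0 ≤ c / 2 * ((1 + ξ) - C₁ / c * |δ|) ^ 2 := by positivity
  have h4 : c / 2 * ((1 + ξ) - C₁ / c * |δ|) ^ 2 = c / 2 * (1 + ξ) ^ 2 - C₁ * (1 + ξ) * |δ| +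
      C₁ ^ 2 / (2 * c) * δ ^ 2 := by
    rw [← sq_abs δ]
    field_simp
    ring
  linarith

end Parameters

section Cutoff

/-- Cutoff functions between `ball 0 R` and `ball 0 (2 * R)` with gradient of size `1/R`. -/
theorem exists_cutoff (n : ℕ) : ∃ C : ℝ, 0 < C ∧ ∀ R : ℝ, 0 < R →
    ∃ η : EuclideanSpace ℝ (Fin n) → ℝ, ContDiff ℝ 1 η ∧ HasCompactSupport η ∧
      (∀ x, 0 ≤ η x) ∧ (∀ x, η x ≤ 1) ∧ (∀ x ∈ Metric.ball 0 R, η x = 1) ∧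
      (∀ x ∉ Metric.ball 0 (2 * R), η x = 0) ∧
      ∀ x, ∑ i, partialD i η x ^ 2 ≤ C / R ^ 2 := by
  let b : ContDiffBump (0 : EuclideanSpace ℝ (Fin n)) := ⟨1, 2, one_pos, one_lt_two⟩
  have hb : ContDiff ℝ 1 b := b.contDiff
  have hcont : Continuous fun x => ∑ i, partialD i b x ^ 2 :=
    continuous_finsetSum _ fun i _ => (hb.continuous_partialD i).pow 2
  have hcs : HasCompactSupport fun x => ∑ i, partialD i b x ^ 2 := by
    refine HasCompactSupport.of_support_subset_isCompact b.hasCompactSupport fun x hx => ?_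
    by_contra h
    refine hx (Finset.sum_eq_zero fun i _ => ?_)
    have : (b : EuclideanSpace ℝ (Fin n) → ℝ) =ᶠ[𝓝 x] fun _ => 0 :=
      notMem_tsupport_iff_eventuallyEq.mp h
    simp [partialD, this.fderiv_eq]
  obtain ⟨C, hC⟩ := hcont.bounded_above_of_compact_support hcs
  refine ⟨max C 1, by positivity, fun R hR => ?_⟩
  have hlin : ContDiff ℝ 1 fun x : EuclideanSpace ℝ (Fin n) => R⁻¹ • x := by fun_prop
  have hnorm : ∀ x : EuclideanSpace ℝ (Fin n), ‖R⁻¹ • x‖ = ‖x‖ / R := fun x => by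
    rw [norm_smul, norm_inv, Real.norm_of_nonneg hR.le]; field_simp
  have hz : ∀ x ∉ Metric.ball (0 : EuclideanSpace ℝ (Fin n)) (2 * R), b (R⁻¹ • x) = 0 := by
    intro x hx
    apply b.zero_of_le_dist
    rw [Metric.mem_ball, not_lt, dist_zero_right] at hx
    rw [dist_zero_right, hnorm, le_div_iff₀ hR]
    exact hx
  refine ⟨fun x => b (R⁻¹ • x), hb.comp hlin, ?_, fun x => b.nonneg, fun x => b.le_one, ?_, hz, ?_⟩
  · refine HasCompactSupport.of_support_subset_isCompact
      (isCompact_closedBall (0 : EuclideanSpace ℝ (Fin n)) (2 * R)) fun x hx => ?_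
    by_contra h
    exact hx (hz x fun h' => h (Metric.ball_subset_closedBall h'))
  · intro x hx
    apply b.one_of_mem_closedBall
    rw [Metric.mem_ball, dist_zero_right] at hx
    rw [Metric.mem_closedBall, dist_zero_right, hnorm, div_le_iff₀ hR]
    change ‖x‖ ≤ 1 * R
    linarith
  · intro x
    have e : ∀ i, partialD i (fun x => b (R⁻¹ • x)) x = R⁻¹ * partialD i b (R⁻¹ • x) := by
      intro i
      simp only [partialD]
      rw [fderiv_comp_smul]
      simp
    simp only [e, mul_pow, ← Finset.mul_sum]
    have h1 := (le_abs_self _).trans (hC (R⁻¹ • x))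
    rw [inv_pow, inv_mul_eq_div]
    gcongr
    exact h1.trans (le_max_left _ _)

/-- A nonnegative continuous function dominated by a mean-zero function up to a small error on
large balls vanishes identically. -/
theorem eq_zero_of_integral_bound {n : ℕ} {f : EuclideanSpace ℝ (Fin n) → ℝ} (hf : Continuous f)
    (hf0 : ∀ x, 0 ≤ f x) {C d : ℝ} (hd : (n : ℝ) < d)
    (h : ∀ R : ℝ, 1 ≤ R → ∃ I : EuclideanSpace ℝ (Fin n) → ℝ, Integrable I ∧ ∫ x, I x = 0 ∧
      ∀ x, (Metric.ball 0 R).indicator f x ≤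
        I x + (Metric.ball 0 (2 * R)).indicator (fun _ => C * R ^ (-d)) x) (x) : f x = 0 := by
  by_contra hx
  have hbi : ∀ R, Integrable ((Metric.ball 0 R).indicator f) := fun R =>
    IntegrableOn.integrable_indicator ((hf.continuousOn.integrableOn_compact
      (isCompact_closedBall 0 R)).mono_set Metric.ball_subset_closedBall) measurableSet_ball
  set r := ‖x‖ + 1 with hr
  have hr1 : 1 ≤ r := by have := norm_nonneg x; linarith
  have hpos : 0 < ∫ y, (Metric.ball 0 r).indicator f y := by
    rw [integral_indicator measurableSet_ball,
      setIntegral_pos_iff_support_of_nonneg_ae (Eventually.of_forall hf0)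
      ((integrable_indicator_iff measurableSet_ball).mp (hbi r))]
    refine (IsOpen.inter hf.isOpen_support Metric.isOpen_ball).measure_pos _
      ⟨x, hx, ?_⟩
    rw [Metric.mem_ball, dist_zero_right]; linarith
  set m := (volume (Metric.ball (0 : EuclideanSpace ℝ (Fin n)) 1)).toReal with hm
  have hbound : ∀ R : ℝ, r ≤ R → ∫ y, (Metric.ball 0 r).indicator f y ≤
      C * 2 ^ n * m * R ^ ((n : ℝ) - d) := by
    intro R hR
    have hR0 : 0 < R := by linarith
    obtain ⟨I, hI, hI0, hle⟩ := h R (by linarith)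
    have hci : Integrable ((Metric.ball (0 : EuclideanSpace ℝ (Fin n)) (2 * R)).indicator
        (fun _ => C * R ^ (-d))) :=
      (integrable_indicator_iff measurableSet_ball).mpr
        (integrableOn_const measure_ball_lt_top.ne)
    have h1 : ∫ y, (Metric.ball 0 r).indicator f y ≤
        ∫ y, (I y + (Metric.ball 0 (2 * R)).indicator (fun _ => C * R ^ (-d)) y) := by
      refine integral_mono (hbi r) (hI.add hci) fun y => ?_
      refine (indicator_le_indicator_of_subset (Metric.ball_subset_ball hR) hf0 y).trans (hle y)
    rw [integral_add hI hci, hI0, zero_add] at h1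
    refine h1.trans_eq ?_
    rw [integral_indicator measurableSet_ball,
      setIntegral_const, Measure.real, Measure.addHaar_ball_of_pos _ _ (by positivity)]
    simp only [finrank_euclideanSpace, Fintype.card_fin, ENNReal.toReal_mul, smul_eq_mul]
    rw [ENNReal.toReal_ofReal (by positivity), sub_eq_add_neg, Real.rpow_add hR0,
      Real.rpow_natCast, mul_pow]
    ring
  have hlim : Tendsto (fun R : ℝ => C * 2 ^ n * m * R ^ ((n : ℝ) - d)) atTop (𝓝 0) := by
    have := (tendsto_rpow_neg_atTop (y := d - n) (by linarith)).const_mul (C * 2 ^ n * m)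
    simpa using this
  have := ge_of_tendsto hlim ((eventually_ge_atTop r).mono hbound)
  linarith

end Cutoff

section LowerBound

theorem deriv_deriv_nonneg_of_isLocalMin {f : ℝ → ℝ} {t : ℝ} (h : IsLocalMin f t)
    (hc : ContinuousAt f t) : 0 ≤ deriv (deriv f) t := by
  by_contra hneg
  rw [not_le] at hneg
  have hmax : IsLocalMax f t := isLocalMax_of_deriv_deriv_neg hneg h.deriv_eq_zero hc
  have hconst : f =ᶠ[𝓝 t] fun _ => f t := by
    filter_upwards [h, hmax] with y h1 h2 using le_antisymm h2 h1
  have h1 : deriv f =ᶠ[𝓝 t] fun _ => 0 := by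
    filter_upwards [hconst.eventuallyEq_nhds] with y hy
    rw [hy.deriv_eq, deriv_const]
  rw [h1.deriv_eq, deriv_const] at hneg
  exact lt_irrefl _ hneg

variable {n : ℕ}

theorem hasDerivAt_comp_add_single {f : EuclideanSpace ℝ (Fin n) → ℝ}
    (x : EuclideanSpace ℝ (Fin n)) (i : Fin n) (t : ℝ)
    (hf : DifferentiableAt ℝ f (x + t • EuclideanSpace.single i 1)) :
    HasDerivAt (fun t : ℝ => f (x + t • EuclideanSpace.single i 1))
      (partialD i f (x + t • EuclideanSpace.single i 1)) t := by
  have h1 : HasDerivAt (fun t : ℝ => x + t • (EuclideanSpace.single i 1 :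
      EuclideanSpace ℝ (Fin n))) (EuclideanSpace.single i 1) t := by
    have := ((hasDerivAt_id t).smul_const (EuclideanSpace.single i 1 :
      EuclideanSpace ℝ (Fin n))).const_add x
    simpa using this
  exact hf.hasFDerivAt.comp_hasDerivAt t h1

theorem norm_add_single_sq (x : EuclideanSpace ℝ (Fin n)) (i : Fin n) (t : ℝ) :
    ‖x + t • EuclideanSpace.single i (1 : ℝ)‖ ^ 2 = ‖x‖ ^ 2 + 2 * t * x i + t ^ 2 := by
  rw [norm_add_sq_real, norm_smul, inner_smul_right, EuclideanSpace.inner_single_right]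
  simp
  ring

/-- At a local minimum of `u - c ‖·‖^(-a)` away from the origin the Laplacian of `u` is bounded
below by that of `c ‖·‖^(-a)`. -/
theorem elaplacian_ge_of_isLocalMin {u : EuclideanSpace ℝ (Fin n) → ℝ} (hu : ContDiff ℝ 2 u)
    {a c : ℝ} {x : EuclideanSpace ℝ (Fin n)} (hx : x ≠ 0)
    (hmin : IsLocalMin (fun y => u y - c * (‖y‖ ^ 2) ^ (-a / 2)) x) :
    c * (a * (a + 2 - n) * (‖x‖ ^ 2) ^ (-a / 2 - 1)) ≤ elaplacian u x := by
  set r := ‖x‖ ^ 2 with hr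
  have hr0 : 0 < r := by have := norm_pos_iff.mpr hx; positivity
  have hi : ∀ i : Fin n, c * (-a / 2 * ((-a / 2 - 1) * r ^ (-a / 2 - 1 - 1) * (2 * x i) * (2 * x i) +
      r ^ (-a / 2 - 1) * 2)) ≤ partialD i (partialD i u) x := by
    intro i
    set L : ℝ → EuclideanSpace ℝ (Fin n) := fun t => x + t • EuclideanSpace.single i 1 with hL
    have hL0 : L 0 = x := by simp [hL]
    have hLc : Continuous L := by fun_prop
    have hrt : ∀ t, ‖L t‖ ^ 2 = r + 2 * t * x i + t ^ 2 := fun t => norm_add_single_sq x i t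
    set w : ℝ → ℝ := fun t => r + 2 * t * x i + t ^ 2 with hw
    have hw' : ∀ t, HasDerivAt w (2 * x i + 2 * t) t := fun t => by
      have h1 : HasDerivAt w _ t :=
        ((((hasDerivAt_id t).const_mul 2).mul_const (x i)).const_add r).add (hasDerivAt_pow 2 t)
      exact h1.congr_deriv (by simp)
    have hw0 : w 0 = r := by simp [hw]
    have hwpos : ∀ᶠ t in 𝓝 (0 : ℝ), 0 < w t := by
      have : ContinuousAt w 0 := (hw' 0).continuousAt
      exact this.eventually (lt_mem_nhds (by rw [hw0]; exact hr0))
    have hd1 : ∀ t, 0 < w t → HasDerivAt (fun t => u (L t) - c * w t ^ (-a / 2))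
        (partialD i u (L t) - c * ((2 * x i + 2 * t) * (-a / 2) * w t ^ (-a / 2 - 1))) t := by
      intro t ht
      exact (hasDerivAt_comp_add_single x i t (hu.differentiable (by norm_num) _)).sub
        (((hw' t).rpow_const (Or.inl ht.ne')).const_mul c)
    have hmin' : IsLocalMin (fun t => u (L t) - c * w t ^ (-a / 2)) 0 := by
      have h1 : Tendsto L (𝓝 0) (𝓝 x) := by
        have := hLc.tendsto 0
        rwa [hL0] at this
      have h2 := h1.eventually hmin
      filter_upwards [h2] with t ht
      rw [hrt t] at ht
      rw [hL0, hw0]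
      exact ht
    have h0 := deriv_deriv_nonneg_of_isLocalMin hmin' (hd1 0 (by rw [hw0]; exact hr0)).continuousAt
    have he : deriv (fun t => u (L t) - c * w t ^ (-a / 2)) =ᶠ[𝓝 0] fun t =>
        partialD i u (L t) - c * ((2 * x i + 2 * t) * (-a / 2) * w t ^ (-a / 2 - 1)) := by
      filter_upwards [hwpos] with t ht using (hd1 t ht).deriv
    have h2x : HasDerivAt (fun t : ℝ => (2 * x i + 2 * t) * (-a / 2)) (2 * (-a / 2)) 0 := by
      have := (((hasDerivAt_id (0 : ℝ)).const_mul 2).const_add (2 * x i)).mul_const (-a / 2)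
      simpa using this
    have hd2 : HasDerivAt (fun t =>
        partialD i u (L t) - c * ((2 * x i + 2 * t) * (-a / 2) * w t ^ (-a / 2 - 1))) _ 0 :=
      (hasDerivAt_comp_add_single x i 0
        ((hu.partialD (m := 1) (by norm_num) i).differentiable (by norm_num) _)).sub
      ((h2x.mul ((hw' 0).rpow_const (p := -a / 2 - 1)
        (Or.inl (by rw [hw0]; exact hr0.ne')))).const_mul c)
    rw [he.deriv_eq, hd2.deriv] at h0
    have hx0 : x + (0 : ℝ) • EuclideanSpace.single i (1 : ℝ) = x := by simp
    rw [hx0, hw0] at h0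
    refine le_of_sub_nonneg (h0.trans_eq ?_)
    ring
  rw [elaplacian_eq_sum]
  refine le_trans (le_of_eq ?_) (Finset.sum_le_sum fun i _ => hi i)
  have hsum : ∑ i, x i ^ 2 = r := by rw [hr, EuclideanSpace.norm_sq_eq]; simp
  have hrr : r ^ (-a / 2 - 1) = r ^ (-a / 2 - 1 - 1) * r := by
    rw [Real.rpow_sub_one hr0.ne' (-a / 2 - 1)]; field_simp
  have e : ∀ i : Fin n, c * (-a / 2 * ((-a / 2 - 1) * r ^ (-a / 2 - 1 - 1) * (2 * x i) * (2 * x i) +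
      r ^ (-a / 2 - 1) * 2)) = c * a * (a + 2) * r ^ (-a / 2 - 1 - 1) * x i ^ 2 -
      c * a * r ^ (-a / 2 - 1) := fun i => by ring
  simp only [e, Finset.sum_sub_distrib, ← Finset.mul_sum, hsum, Finset.sum_const,
    Finset.card_univ, Fintype.card_fin, nsmul_eq_mul]
  rw [hrr]
  ring

/-- Positive superharmonic functions decay at most like a power slightly worse than the
fundamental solution. -/
theorem superharmonic_lower_bound (hn : 3 ≤ n) {u : EuclideanSpace ℝ (Fin n) → ℝ}
    (hu : ContDiff ℝ 2 u) (hpos : ∀ x, 0 < u x) (hsup : ∀ x, elaplacian u x ≤ 0) {a : ℝ}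
    (ha : (n : ℝ) - 2 < a) : ∃ c : ℝ, 0 < c ∧ ∀ x, 1 ≤ ‖x‖ → c * ‖x‖ ^ (-a) ≤ u x := by
  have hn3 : (3 : ℝ) ≤ n := by exact_mod_cast hn
  have ha0 : 0 < a := by linarith
  have hrp : ∀ y : EuclideanSpace ℝ (Fin n), ‖y‖ ^ (-a) = (‖y‖ ^ 2) ^ (-a / 2) := fun y => by
    rw [← Real.rpow_natCast, ← Real.rpow_mul (norm_nonneg y)]
    congr 1
    push_cast
    ring
  have : Nonempty (Fin n) := ⟨⟨0, by omega⟩⟩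
  have hne : (Metric.sphere (0 : EuclideanSpace ℝ (Fin n)) 1).Nonempty :=
    NormedSpace.sphere_nonempty.mpr zero_le_one
  obtain ⟨z, -, hz⟩ := (isCompact_sphere (0 : EuclideanSpace ℝ (Fin n)) 1).exists_isMinOn hne
    hu.continuous.continuousOn
  refine ⟨u z, hpos z, fun x hx => ?_⟩
  by_contra hlt
  rw [not_le] at hlt
  set c := u z with hc
  have hc0 : 0 < c := hpos z
  set g : EuclideanSpace ℝ (Fin n) → ℝ := fun y => u y - c * (‖y‖ ^ 2) ^ (-a / 2) with hg
  have hgx : g x < 0 := by simp only [hg]; rw [← hrp]; linarith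
  have hlim : Tendsto (fun R : ℝ => c * R ^ (-a)) atTop (𝓝 0) := by
    simpa using (tendsto_rpow_neg_atTop ha0).const_mul c
  obtain ⟨R, hR1, hR2⟩ := ((hlim.eventually (gt_mem_nhds (show (0 : ℝ) < -g x by linarith))).and
    (eventually_gt_atTop ‖x‖)).exists
  let A : Set (EuclideanSpace ℝ (Fin n)) := Metric.closedBall 0 R ∩ {y | 1 ≤ ‖y‖}
  have hA : IsCompact A :=
    (isCompact_closedBall _ _).inter_right (isClosed_le continuous_const continuous_norm)
  have hxA : x ∈ A := ⟨by rw [Metric.mem_closedBall, dist_zero_right]; exact hR2.le, hx⟩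
  have hgc : ContinuousOn g A := by
    refine hu.continuous.continuousOn.sub (continuousOn_const.mul ?_)
    refine ContinuousOn.rpow_const (by fun_prop) fun y hy => Or.inl ?_
    have : 1 ≤ ‖y‖ := hy.2
    positivity
  obtain ⟨y, hyA, hy⟩ := hA.exists_isMinOn ⟨x, hxA⟩ hgc
  have hyx : g y ≤ g x := hy hxA
  have hy1 : 1 ≤ ‖y‖ := hyA.2
  have hyR : ‖y‖ ≤ R := by
    have := hyA.1
    rwa [Metric.mem_closedBall, dist_zero_right] at this
  have hy1' : 1 < ‖y‖ := by
    refine lt_of_le_of_ne hy1 fun h => ?_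
    have h1 : c ≤ u y := hz (by rw [mem_sphere_zero_iff_norm]; exact h.symm)
    have : g y = u y - c := by simp only [hg]; rw [← h]; simp
    linarith
  have hyR' : ‖y‖ < R := by
    refine lt_of_le_of_ne hyR fun h => ?_
    have : g y = u y - c * R ^ (-a) := by simp only [hg]; rw [← hrp, h]
    have := hpos y
    linarith
  have hy0 : y ≠ 0 := by
    rw [← norm_pos_iff]; linarith
  have hloc : IsLocalMin g y := by
    have hnhds : A ∈ 𝓝 y := by
      have ho : IsOpen {y : EuclideanSpace ℝ (Fin n) | 1 < ‖y‖ ∧ ‖y‖ < R} :=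
        (isOpen_lt continuous_const continuous_norm).inter
          (isOpen_lt continuous_norm continuous_const)
      refine mem_of_superset (ho.mem_nhds ⟨hy1', hyR'⟩) fun z hz => ⟨?_, hz.1.le⟩
      rw [Metric.mem_closedBall, dist_zero_right]; exact hz.2.le
    exact hy.isLocalMin hnhds
  have h1 := elaplacian_ge_of_isLocalMin hu hy0 hloc
  have h2 : 0 < c * (a * (a + 2 - n) * (‖y‖ ^ 2) ^ (-a / 2 - 1)) := by
    have : 0 < a + 2 - n := by linarith
    have : 0 < ‖y‖ ^ 2 := by positivity
    positivity
  linarith [hsup y]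

end LowerBound

section Transform

variable {n : ℕ} {u : EuclideanSpace ℝ (Fin n) → ℝ}

theorem elaplacian_comp (hu : ContDiff ℝ 2 u) (hpos : ∀ x, 0 < u x) {h h' : ℝ → ℝ} {h'' : ℝ}
    {x : EuclideanSpace ℝ (Fin n)} (hh : ∀ t, 0 < t → HasDerivAt h (h' t) t)
    (hh' : HasDerivAt h' h'' (u x)) :
    elaplacian (fun y => h (u y)) x = h'' * ‖gradient u x‖ ^ 2 + h' (u x) * elaplacian u x := by
  have hud : Differentiable ℝ u := hu.differentiable (by norm_num)
  have h1 : ∀ i, partialD i (fun y => h (u y)) = fun y => h' (u y) * partialD i u y := fun i => by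
    funext y
    exact partialD_comp (hh _ (hpos y)) (hud y) i
  have hd : DifferentiableAt ℝ (fun y => h' (u y)) x :=
    (hh'.comp_hasFDerivAt x (hud x).hasFDerivAt).differentiableAt
  have h2 : ∀ i, partialD i (partialD i (fun y => h (u y))) x =
      h'' * partialD i u x ^ 2 + h' (u x) * partialD i (partialD i u) x := fun i => by
    rw [h1, partialD_mul hd ((hu.partialD (m := 1) (by norm_num) i).differentiable (by norm_num) x),
      partialD_comp hh' (hud x)]
    ring
  rw [elaplacian_eq_sum, elaplacian_eq_sum, norm_gradient_sq]
  simp only [h2, Finset.sum_add_distrib, Finset.mul_sum]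

theorem norm_gradient_comp {h : ℝ → ℝ} {h' : ℝ} {x : EuclideanSpace ℝ (Fin n)}
    (hud : DifferentiableAt ℝ u x) (hh : HasDerivAt h h' (u x)) :
    ‖gradient (fun y => h (u y)) x‖ = |h'| * ‖gradient u x‖ := by
  rw [← sq_eq_sq₀ (norm_nonneg _) (by positivity), mul_pow, norm_gradient_sq, norm_gradient_sq,
    sq_abs, Finset.mul_sum]
  exact Finset.sum_congr rfl fun i _ => by rw [partialD_comp hh hud]; ring

/-- The power substitution turning the equation into one with homogeneous nonlinearity. -/
theorem exists_power_transform (hn : 3 ≤ n) {p q k : ℝ} (hq1 : q < 1) (hk : 0 < k)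
    (hkpq : k * (p + q - 1) = 2 - q) (hu : ContDiff ℝ 2 u) (hpos : ∀ x, 0 < u x)
    (heq : ∀ x, elaplacian u x + ‖gradient u x‖ ^ q * u x ^ p = 0) :
    ∃ v : EuclideanSpace ℝ (Fin n) → ℝ, ContDiff ℝ 2 v ∧ (∀ x, 0 < v x) ∧
      (∀ x, elaplacian v x = ((1 + k) * ‖gradient v x‖ ^ 2 + ‖gradient v x‖ ^ q) / v x) ∧
      (∀ a : ℝ, (n : ℝ) - 2 < a → ∃ D : ℝ, 0 < D ∧ ∀ R : ℝ, 1 ≤ R →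
        ∀ x ∈ Metric.ball (0 : EuclideanSpace ℝ (Fin n)) (2 * R), v x ≤ D * R ^ (a / k)) ∧
      ∀ x, gradient v x = 0 → gradient u x = 0 := by
  set l := 1 / k with hl
  have hl0 : 0 < l := by positivity
  set C := l ^ (-(1 - q) / (2 - q)) with hC
  have hC0 : 0 < C := Real.rpow_pos_of_pos hl0 _
  have hCl : l ^ (1 - q) * C ^ (2 - q) = 1 := by
    rw [hC, ← Real.rpow_mul hl0.le, ← Real.rpow_add hl0]
    have : 1 - q + -(1 - q) / (2 - q) * (2 - q) = 0 := by
      have : 2 - q ≠ 0 := by linarith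
      field_simp
      ring
    rw [this, Real.rpow_zero]
  have hud : Differentiable ℝ u := hu.differentiable (by norm_num)
  set v : EuclideanSpace ℝ (Fin n) → ℝ := fun x => C * u x ^ (-l) with hv
  have hv2 : ContDiff ℝ 2 v :=
    contDiff_const.mul (hu.rpow_const_of_ne fun x => (hpos x).ne')
  have hv0 : ∀ x, 0 < v x := fun x => mul_pos hC0 (Real.rpow_pos_of_pos (hpos x) _)
  have hd1 : ∀ t : ℝ, 0 < t → HasDerivAt (fun t : ℝ => C * t ^ (-l))
      (C * (-l * t ^ (-l - 1))) t := fun t ht =>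
    (Real.hasDerivAt_rpow_const (Or.inl ht.ne')).const_mul C
  have hd2 : ∀ t : ℝ, 0 < t → HasDerivAt (fun t : ℝ => C * (-l * t ^ (-l - 1)))
      (C * (-l * ((-l - 1) * t ^ (-l - 1 - 1)))) t := fun t ht =>
    ((Real.hasDerivAt_rpow_const (Or.inl ht.ne')).const_mul (-l)).const_mul C
  have hgrad : ∀ x, ‖gradient v x‖ = l * v x / u x * ‖gradient u x‖ := fun x => by
    rw [hv, norm_gradient_comp (hud x) (hd1 _ (hpos x)), Real.rpow_sub_one (hpos x).ne']
    congr 1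
    rw [show C * (-l * (u x ^ (-l) / u x)) = -(l * (C * u x ^ (-l)) / u x) by ring, abs_neg,
      abs_of_pos]
    have := hv0 x
    have := hpos x
    positivity
  have hgu : ∀ x, ‖gradient u x‖ = ‖gradient v x‖ * (u x / (l * v x)) := fun x => by
    rw [hgrad]
    have := (hv0 x).ne'
    have := (hpos x).ne'
    field_simp
  refine ⟨v, hv2, hv0, fun x => ?_, fun a ha => ?_, fun x hx => ?_⟩
  · have hux := hpos x
    have hvx := hv0 x
    have h1 : elaplacian v x = C * (-l * ((-l - 1) * u x ^ (-l - 1 - 1))) * ‖gradient u x‖ ^ 2 +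
        C * (-l * u x ^ (-l - 1)) * elaplacian u x := elaplacian_comp hu hpos hd1 (hd2 _ hux)
    have h2 : elaplacian u x = -(‖gradient u x‖ ^ q * u x ^ p) := by linarith [heq x]
    rw [h1, h2, Real.rpow_sub_one hux.ne' (-l - 1), Real.rpow_sub_one hux.ne']
    have hS0 : 0 ≤ ‖gradient v x‖ := norm_nonneg _
    have h3 : ‖gradient u x‖ ^ q = ‖gradient v x‖ ^ q * (u x ^ q / (l ^ q * v x ^ q)) := by
      rw [hgu, Real.mul_rpow hS0 (by positivity), Real.div_rpow hux.le (by positivity),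
        Real.mul_rpow hl0.le hvx.le]
    have h4 : C * u x ^ (-l) = v x := rfl
    have h5 : l * v x ^ 2 * u x ^ p * u x ^ q / (u x * (l ^ q * v x ^ q)) = 1 := by
      have e1 : v x ^ (2 - q) = C ^ (2 - q) * (u x / (u x ^ p * u x ^ q)) := by
        rw [← h4, Real.mul_rpow hC0.le (Real.rpow_nonneg hux.le _), ← Real.rpow_mul hux.le,
          ← Real.rpow_add hux]
        congr 1
        have : -l * (2 - q) = 1 - (p + q) := by
          rw [hl, ← hkpq]; field_simp; ring
        rw [this, Real.rpow_sub hux, Real.rpow_one]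
      have e2 : v x ^ (2 - q) = v x ^ 2 / v x ^ q := by
        rw [Real.rpow_sub hvx]; norm_num
      have e3 : l ^ (1 - q) = l / l ^ q := by rw [Real.rpow_sub hl0, Real.rpow_one]
      have p1 : 0 < u x ^ p := Real.rpow_pos_of_pos hux _
      have p2 : 0 < u x ^ q := Real.rpow_pos_of_pos hux _
      have p3 : 0 < v x ^ q := Real.rpow_pos_of_pos hvx _
      have p4 : 0 < l ^ q := Real.rpow_pos_of_pos hl0 _
      calc l * v x ^ 2 * u x ^ p * u x ^ q / (u x * (l ^ q * v x ^ q)) =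
          (l / l ^ q) * (v x ^ 2 / v x ^ q) * (u x ^ p * u x ^ q / u x) := by
            field_simp
        _ = l ^ (1 - q) * C ^ (2 - q) *
            ((u x / (u x ^ p * u x ^ q)) * (u x ^ p * u x ^ q / u x)) := by
            rw [← e3, ← e2, e1]; ring
        _ = 1 := by rw [hCl]; field_simp
    rw [h3]
    have h6 : ‖gradient u x‖ ^ 2 = (‖gradient v x‖ * (u x / (l * v x))) ^ 2 := by rw [hgu]
    rw [h6]
    have h7 : C * (-l * ((-l - 1) * (u x ^ (-l) / u x / u x))) *
        (‖gradient v x‖ * (u x / (l * v x))) ^ 2 +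
        C * (-l * (u x ^ (-l) / u x)) *
          -(‖gradient v x‖ ^ q * (u x ^ q / (l ^ q * v x ^ q)) * u x ^ p) =
        (C * u x ^ (-l)) * (l * (l + 1) * (‖gradient v x‖ / (l * v x)) ^ 2) +
        (C * u x ^ (-l)) / v x ^ 2 * ‖gradient v x‖ ^ q *
          (l * v x ^ 2 * u x ^ p * u x ^ q / (u x * (l ^ q * v x ^ q))) := by
      field_simp
      ring
    rw [h7, h5, h4]
    have hkl : k = 1 / l := by rw [hl]; field_simp
    rw [hkl]
    field_simp
  · have hsup : ∀ x, elaplacian u x ≤ 0 := fun x => by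
      have := mul_nonneg (Real.rpow_nonneg (norm_nonneg (gradient u x)) q)
        (Real.rpow_nonneg (hpos x).le p)
      linarith [heq x]
    obtain ⟨c, hc0, hc⟩ := superharmonic_lower_bound hn hu hpos hsup ha
    have ha0 : 0 < a := by
      have : (3 : ℝ) ≤ n := by exact_mod_cast hn
      linarith
    obtain ⟨M, hM⟩ := (isCompact_closedBall (0 : EuclideanSpace ℝ (Fin n)) 1).bddAbove_image
      hv2.continuous.continuousOn
    refine ⟨max M (C * c ^ (-l) * 2 ^ (a / k)), lt_max_of_lt_right (by positivity),
      fun R hR x hx => ?_⟩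
    have hR0 : 0 < R := by linarith
    rcases le_total ‖x‖ 1 with h | h
    · have h1 : v x ≤ M := hM ⟨x, by rwa [Metric.mem_closedBall, dist_zero_right], rfl⟩
      have h2 : 1 ≤ R ^ (a / k) := Real.one_le_rpow hR (by positivity)
      have h3 : 0 < M := (hv0 x).trans_le h1
      calc v x ≤ M * 1 := by linarith
        _ ≤ _ := by gcongr; exact le_max_left _ _
    · have hx0 : 0 < ‖x‖ := by linarith
      rw [Metric.mem_ball, dist_zero_right] at hx
      have h1 := hc x h
      have h2 : v x ≤ C * (c * ‖x‖ ^ (-a)) ^ (-l) := by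
        simp only [hv]
        gcongr ?_ * ?_
        exact Real.rpow_le_rpow_of_nonpos (by positivity) h1 (by linarith)
      have h3 : (c * ‖x‖ ^ (-a)) ^ (-l) = c ^ (-l) * ‖x‖ ^ (a / k) := by
        rw [Real.mul_rpow hc0.le (Real.rpow_nonneg hx0.le _), ← Real.rpow_mul hx0.le]
        congr 2
        rw [hl]; ring
      have h4 : ‖x‖ ^ (a / k) ≤ 2 ^ (a / k) * R ^ (a / k) := by
        rw [← Real.mul_rpow (by norm_num) hR0.le]
        gcongr
      calc v x ≤ C * (c ^ (-l) * ‖x‖ ^ (a / k)) := by rw [← h3]; exact h2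
        _ ≤ C * (c ^ (-l) * (2 ^ (a / k) * R ^ (a / k))) := by gcongr
        _ = C * c ^ (-l) * 2 ^ (a / k) * R ^ (a / k) := by ring
        _ ≤ _ := by gcongr; exact le_max_right _ _
  · rw [← norm_eq_zero, hgu x, hx, norm_zero, zero_mul]

theorem eq_of_gradient_eq_zero (hu : ContDiff ℝ 2 u) (h : ∀ x, gradient u x = 0) (x y) :
    u x = u y := by
  refine is_const_of_fderiv_eq_zero (𝕜 := ℝ) (hu.differentiable (by norm_num)) (fun z => ?_) x y
  rw [← toDual_gradient, h z, map_zero]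

end Transform

section SmallExponent

theorem absorb_cutoff_term {η F θ C R : ℝ} (hη0 : 0 ≤ η) (hη1 : η ≤ 1) (hF : 0 ≤ F) (hθ : 0 < θ)
    (hθ1 : θ < 1) (hC : 0 < C) (hR : 0 < R) {r : ℕ} (hr : 1 / θ - 1 ≤ r) :
    η ^ r * (C / R) * F ^ (1 - θ) ≤
      1 / 2 * η ^ (r + 1) * F + (2 * C) ^ (1 / θ) * R ^ (-(1 / θ)) := by
  have hθ' : 0 < 1 / θ - 1 := by
    have : 1 < 1 / θ := by rwa [lt_div_iff₀ hθ, one_mul]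
    linarith
  have hFs : F ^ θ * F ^ (1 - θ) = F := by
    rw [← Real.rpow_add_of_nonneg hF hθ.le (by linarith)]
    norm_num
  rcases le_total (2 * C / R) (η * F ^ θ) with h | h
  · have h1 : η ^ r * F ^ (1 - θ) * (2 * C / R) ≤ η ^ r * F ^ (1 - θ) * (η * F ^ θ) := by gcongr
    have h2 : η ^ r * F ^ (1 - θ) * (η * F ^ θ) = η ^ (r + 1) * F := by
      rw [pow_succ]
      linear_combination η ^ r * η * hFs
    have h3 : 0 ≤ (2 * C) ^ (1 / θ) * R ^ (-(1 / θ)) := by positivity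
    have h4 : η ^ r * (C / R) * F ^ (1 - θ) = 1 / 2 * (η ^ r * F ^ (1 - θ) * (2 * C / R)) := by ring
    rw [h4]
    linarith
  · have h0 : 0 ≤ η ^ (r + 1) * F := by positivity
    have h1 : η ^ r * F ^ (1 - θ) ≤ (2 * C / R) ^ (1 / θ - 1) := by
      calc η ^ r * F ^ (1 - θ) ≤ η ^ (1 / θ - 1) * F ^ (1 - θ) := by
            gcongr
            rw [← Real.rpow_natCast]
            exact Real.rpow_le_rpow_of_exponent_ge' hη0 hη1 hθ'.le hr
        _ = (η * F ^ θ) ^ (1 / θ - 1) := by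
            rw [Real.mul_rpow hη0 (by positivity), ← Real.rpow_mul hF]
            congr 2
            field_simp
        _ ≤ _ := Real.rpow_le_rpow (by positivity) h hθ'.le
    have h2 : (2 * C) ^ (1 / θ) * R ^ (-(1 / θ)) = (2 * C / R) ^ (1 / θ - 1) * (2 * C / R) := by
      rw [← Real.rpow_add_one (by positivity), Real.rpow_neg hR.le,
        Real.div_rpow (by positivity) hR.le, sub_add_cancel]
      exact (div_eq_mul_inv _ _).symm
    rw [h2]
    have h3 : η ^ r * (C / R) * F ^ (1 - θ) ≤ C / R * (2 * C / R) ^ (1 / θ - 1) := by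
      calc _ = C / R * (η ^ r * F ^ (1 - θ)) := by ring
        _ ≤ _ := by gcongr
    have h4 : C / R * (2 * C / R) ^ (1 / θ - 1) ≤ (2 * C / R) ^ (1 / θ - 1) * (2 * C / R) := by
      have : 0 ≤ C / R * (2 * C / R) ^ (1 / θ - 1) := by positivity
      calc _ ≤ 2 * (C / R * (2 * C / R) ^ (1 / θ - 1)) := by linarith
        _ = _ := by ring
    linarith

theorem exists_interpolation_exponents {N p q : ℝ} (hN : 2 < N) (hq1 : q < 1)
    (h : (N - 2) * (q + 2 * p) < N * (2 - q)) :
    ∃ α β θ γ : ℝ, 0 < α ∧ 0 < β ∧ 0 < θ ∧ θ < 1 ∧ N < 1 / θ ∧ 0 < γ ∧ q * β + 2 * α = 1 ∧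
      α + β + θ = 1 ∧ (p - γ) * β - (γ + 1) * α = -γ := by
  have hq2 : 0 < 2 - q := by linarith
  have hM : 0 < max (q + 2 * p) (2 - q) := lt_max_of_lt_right hq2
  obtain ⟨β, hβ1, hβ2⟩ := exists_between (show (N - 2) / (N * (2 - q)) <
      1 / max (q + 2 * p) (2 - q) by
    rw [div_lt_div_iff₀ (by positivity) hM, one_mul, mul_max_of_nonneg _ _ (by linarith)]
    exact max_lt h (by nlinarith))
  rw [lt_div_iff₀ hM] at hβ2
  have hβ : 0 < β := lt_trans (div_pos (by linarith) (by positivity)) hβ1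
  rw [div_lt_iff₀ (by positivity)] at hβ1
  rw [mul_max_of_nonneg _ _ hβ.le, max_lt_iff] at hβ2
  obtain ⟨h1, h2⟩ := hβ2
  have hθ : 0 < 1 - β * (2 - q) := by linarith
  refine ⟨(1 - q * β) / 2, β, (1 - β * (2 - q)) / 2, (1 - β * (q + 2 * p)) / (1 - β * (2 - q)),
    by nlinarith, hβ, by linarith, by nlinarith [mul_pos hβ hq2], ?_, div_pos (by linarith) hθ,
    by ring, by ring, ?_⟩
  · rw [lt_div_iff₀ (by linarith)]
    nlinarith
  · field_simp
    ring

/-- The interpolation inequality between the two good terms of the divergence identity. -/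
theorem weighted_gradient_le_interpolation {u s p q α β θ γ : ℝ} (hu : 0 < u) (hs : 0 ≤ s)
    (hα : 0 < α) (hβ : 0 < β) (hγ : 0 < γ) (h1 : q * β + 2 * α = 1)
    (h2 : α + β + θ = 1) (h3 : (p - γ) * β - (γ + 1) * α = -γ) :
    u ^ (-γ) * s ≤
      γ ^ (-α) * (s ^ q * u ^ p * u ^ (-γ) + γ * (u ^ (-γ - 1) * s ^ 2)) ^ (1 - θ) := by
  rcases hs.eq_or_lt with rfl | hs
  · rw [mul_zero]
    have : (0 : ℝ) ≤ 0 ^ q := Real.rpow_nonneg le_rfl _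
    positivity
  set F := s ^ q * u ^ p * u ^ (-γ) + γ * (u ^ (-γ - 1) * s ^ 2) with hF
  have hF0 : 0 < F := by positivity
  have hX : s ^ q * u ^ p * u ^ (-γ) ≤ F := by
    have : 0 < γ * (u ^ (-γ - 1) * s ^ 2) := by positivity
    linarith
  have hY : γ * (u ^ (-γ - 1) * s ^ 2) ≤ F := by
    have : 0 < s ^ q * u ^ p * u ^ (-γ) := by positivity
    linarith
  have e : u ^ (-γ) * s = γ ^ (-α) *
      ((s ^ q * u ^ p * u ^ (-γ)) ^ β * (γ * (u ^ (-γ - 1) * s ^ 2)) ^ α) := by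
    rw [Real.mul_rpow (by positivity) (by positivity),
      Real.mul_rpow (by positivity) (by positivity),
      Real.mul_rpow (by positivity) (by positivity), Real.mul_rpow (by positivity) (by positivity),
      ← Real.rpow_natCast s 2, ← Real.rpow_mul hs.le, ← Real.rpow_mul hs.le, ← Real.rpow_mul hu.le,
      ← Real.rpow_mul hu.le, ← Real.rpow_mul hu.le]
    calc u ^ (-γ) * s = γ ^ (-α + α) * (u ^ (p * β + -γ * β + (-γ - 1) * α) *
          s ^ (q * β + ((2 : ℕ) : ℝ) * α)) := by
          have : p * β + -γ * β + (-γ - 1) * α = -γ := by linear_combination h3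
          rw [this]
          push_cast
          rw [h1, neg_add_cancel, Real.rpow_zero, Real.rpow_one, one_mul]
      _ = _ := by
          rw [Real.rpow_add hγ, Real.rpow_add hu, Real.rpow_add hu, Real.rpow_add hs]
          ring
  rw [e, show 1 - θ = β + α by linarith, Real.rpow_add hF0]
  gcongr

variable {n : ℕ} {u : EuclideanSpace ℝ (Fin n) → ℝ}

theorem gradient_eq_zero_of_small_exponent (hn : 3 ≤ n) {p q : ℝ} (hq0 : 0 ≤ q) (hq1 : q < 1)
    (h : ((n : ℝ) - 2) * (q + 2 * p) < n * (2 - q)) (hu : ContDiff ℝ 2 u) (hpos : ∀ x, 0 < u x)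
    (heq : ∀ x, elaplacian u x + ‖gradient u x‖ ^ q * u x ^ p = 0) (x : EuclideanSpace ℝ (Fin n)) :
    gradient u x = 0 := by
  have hn' : (3 : ℝ) ≤ n := by exact_mod_cast hn
  obtain ⟨α, β, θ, γ, hα, hβ, hθ, hθ1, hd, hγ, h1, h2, h3⟩ :=
    exists_interpolation_exponents (by linarith) hq1 h
  obtain ⟨C, hC, hcut⟩ := exists_cutoff n
  obtain ⟨r, hr⟩ := exists_nat_ge (1 / θ)
  have hr1 : r ≠ 0 := by
    rintro rfl
    have : 0 < 1 / θ := by positivity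
    simp at hr
    linarith [inv_pos.mpr hθ]
  have hud : Differentiable ℝ u := hu.differentiable (by norm_num)
  have hgc : Continuous fun x => ‖gradient u x‖ := hu.gradient.continuous.norm
  have hupow : ∀ a : ℝ, Continuous fun x => u x ^ a := fun a =>
    hu.continuous.rpow_const fun x => Or.inl (hpos x).ne'
  set f : EuclideanSpace ℝ (Fin n) → ℝ := fun x => ‖gradient u x‖ ^ q * u x ^ p * u x ^ (-γ) +
    γ * (u x ^ (-γ - 1) * ‖gradient u x‖ ^ 2) with hf
  have hfc : Continuous f := by
    have : Continuous fun x => ‖gradient u x‖ ^ q := hgc.rpow_const fun x => Or.inr hq0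
    have := hupow p
    have := hupow (-γ)
    have := hupow (-γ - 1)
    fun_prop
  have hf0 : ∀ x, 0 ≤ f x := fun x => by
    have := hpos x
    simp only [hf]
    positivity
  set C₁ := ((r : ℝ) + 1) * √C * γ ^ (-α) with hC₁
  have hC₁0 : 0 < C₁ := by positivity
  have key := eq_zero_of_integral_bound (C := 2 * (2 * C₁) ^ (1 / θ)) hfc hf0 hd ?_ x
  · have h4 : 0 < u x := hpos x
    have h5 : 0 ≤ ‖gradient u x‖ ^ q * u x ^ p * u x ^ (-γ) := by positivity
    have h6 : γ * (u x ^ (-γ - 1) * ‖gradient u x‖ ^ 2) = 0 :=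
      le_antisymm (by simp only [hf] at key; linarith) (by positivity)
    have h7 : u x ^ (-γ - 1) ≠ 0 := (Real.rpow_pos_of_pos h4 _).ne'
    simpa [hγ.ne', h7] using h6
  intro R hR
  have hR0 : 0 < R := by linarith
  obtain ⟨η, hη, hηc, hη0, hη1, hηb, hηo, hηg⟩ := hcut R hR0
  have hηd : Differentiable ℝ η := hη.differentiable (by norm_num)
  have hζ : ContDiff ℝ 1 (fun y => η y ^ (r + 1) * u y ^ (-γ)) :=
    (hη.pow _).mul ((hu.of_le (by norm_num)).rpow_const_of_ne fun y => (hpos y).ne')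
  have hζc : HasCompactSupport (fun y => η y ^ (r + 1) * u y ^ (-γ)) := by
    refine HasCompactSupport.mul_right ?_
    exact hηc.comp_left (g := fun t : ℝ => t ^ (r + 1)) (by simp)
  obtain ⟨hi, hi0⟩ := integral_div_mul_grad hu hζ hζc
  refine ⟨_, hi.const_mul (-2), by rw [integral_const_mul, hi0, mul_zero], fun x => ?_⟩
  have hux := hpos x
  have hpζ : ∀ i, partialD i (fun y => η y ^ (r + 1) * u y ^ (-γ)) x =
      ((r : ℝ) + 1) * η x ^ r * u x ^ (-γ) * partialD i η x -
        γ * η x ^ (r + 1) * u x ^ (-γ - 1) * partialD i u x := fun i => by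
    rw [partialD_mul (f := fun y => η y ^ (r + 1)) ((hηd x).pow _)
      ((hud x).rpow_const (Or.inl hux.ne')),
      partialD_comp (hasDerivAt_pow (r + 1) (η x)) (hηd x),
      partialD_comp (Real.hasDerivAt_rpow_const (Or.inl hux.ne')) (hud x)]
    push_cast [Nat.add_sub_cancel]
    ring
  have hI : ∑ i, partialD i (fun y => η y ^ (r + 1) * u y ^ (-γ)) x * partialD i u x +
      η x ^ (r + 1) * u x ^ (-γ) * elaplacian u x =
      ((r : ℝ) + 1) * η x ^ r * u x ^ (-γ) * ∑ i, partialD i η x * partialD i u x -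
        η x ^ (r + 1) * f x := by
    have : elaplacian u x = -(‖gradient u x‖ ^ q * u x ^ p) := by linarith [heq x]
    have hs : ∑ i, partialD i u x * partialD i u x = ‖gradient u x‖ ^ 2 := by
      rw [norm_gradient_sq]
      exact Finset.sum_congr rfl fun i _ => (pow_two _).symm
    rw [this]
    simp only [hf, hpζ, sub_mul, Finset.sum_sub_distrib]
    have e1 : ∀ i, ((r : ℝ) + 1) * η x ^ r * u x ^ (-γ) * partialD i η x * partialD i u x =
      ((r : ℝ) + 1) * η x ^ r * u x ^ (-γ) * (partialD i η x * partialD i u x) := fun i => by ring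
    have e2 : ∀ i, γ * η x ^ (r + 1) * u x ^ (-γ - 1) * partialD i u x * partialD i u x =
      (γ * η x ^ (r + 1) * u x ^ (-γ - 1)) * (partialD i u x * partialD i u x) := fun i => by ring
    simp only [e1, e2, ← Finset.mul_sum, hs]
    ring
  rw [hI]
  by_cases hx : x ∈ Metric.ball 0 (2 * R)
  · rw [indicator_of_mem hx]
    have hcs : |∑ i, partialD i η x * partialD i u x| ≤ √C / R * ‖gradient u x‖ := by
      refine abs_le_of_sq_le_sq ?_ (by positivity)
      refine (Finset.sum_mul_sq_le_sq_mul_sq _ _ _).trans ?_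
      rw [mul_pow, norm_gradient_sq, div_pow, Real.sq_sqrt hC.le]
      gcongr
      exact hηg x
    have h_int := weighted_gradient_le_interpolation (p := p) hux (norm_nonneg (gradient u x)) hα hβ
      hγ h1 h2 h3
    have habs := absorb_cutoff_term (r := r) (hη0 x) (hη1 x) (hf0 x) hθ hθ1 hC₁0 hR0 (by linarith)
    have h4 : ((r : ℝ) + 1) * η x ^ r * u x ^ (-γ) * ∑ i, partialD i η x * partialD i u x ≤
        η x ^ r * (C₁ / R) * f x ^ (1 - θ) := by
      have h0 := hη0 x
      calc _ ≤ ((r : ℝ) + 1) * η x ^ r * u x ^ (-γ) * (√C / R * ‖gradient u x‖) := by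
            gcongr
            exact (abs_le.mp hcs).2
        _ = ((r : ℝ) + 1) * η x ^ r * (√C / R) * (u x ^ (-γ) * ‖gradient u x‖) := by ring
        _ ≤ ((r : ℝ) + 1) * η x ^ r * (√C / R) * (γ ^ (-α) * f x ^ (1 - θ)) := by gcongr
        _ = _ := by rw [hC₁]; ring
    have h5 : (Metric.ball 0 R).indicator f x ≤ η x ^ (r + 1) * f x := by
      by_cases hxR : x ∈ Metric.ball 0 R
      · rw [indicator_of_mem hxR, hηb x hxR, one_pow, one_mul]
      · rw [indicator_of_notMem hxR]
        exact mul_nonneg (pow_nonneg (hη0 x) _) (hf0 x)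
    linarith
  · rw [indicator_of_notMem hx, hηo x hx, indicator_of_notMem]
    · simp [hr1]
    · exact fun h => hx (Metric.ball_subset_ball (by linarith) h)

end SmallExponent

section Weights

/-- The gradient weight `S ^ a * (B + A * S ^ (2 - q)) ^ ν`. -/
noncomputable def gradWeight (A B q ν a S : ℝ) : ℝ := S ^ a * (B + A * S ^ (2 - q)) ^ ν

/-- The multiplier `ε + 1 / (A + B * S ^ (q - 2))`, written so as to be regular at `S = 0`. -/
noncomputable def gradMultiplier (A B q ε S : ℝ) : ℝ :=
  ε + S ^ (2 - q) / (B + A * S ^ (2 - q))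

variable {A B q ν a ε S : ℝ}

theorem gradWeight_nonneg (hA : 0 < A) (hB : 0 < B) (hS : 0 ≤ S) : 0 ≤ gradWeight A B q ν a S := by
  unfold gradWeight
  positivity

theorem gradWeight_pos (hA : 0 < A) (hB : 0 < B) (hS : 0 < S) : 0 < gradWeight A B q ν a S := by
  unfold gradWeight
  positivity

theorem gradWeight_zero (ha : a ≠ 0) : gradWeight A B q ν a 0 = 0 := by
  unfold gradWeight
  rw [Real.zero_rpow ha, zero_mul]

theorem gradWeight_add (hS : 0 < S) (b : ℝ) :
    gradWeight A B q ν (a + b) S = gradWeight A B q ν a S * S ^ b := by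
  unfold gradWeight
  rw [Real.rpow_add hS]
  ring

theorem gradMultiplier_pos (hA : 0 < A) (hB : 0 < B) (hε : 0 < ε) (hS : 0 ≤ S) :
    0 < gradMultiplier A B q ε S := by
  unfold gradMultiplier
  positivity

theorem gradMultiplier_eq (hA : 0 < A) (hB : 0 < B) (hS : 0 < S) :
    gradMultiplier A B q ε S = ε + 1 / (A + B * S ^ (q - 2)) := by
  unfold gradMultiplier
  rw [show q - 2 = -(2 - q) by ring, Real.rpow_neg hS.le]
  have : 0 < S ^ (2 - q) := by positivity
  field_simp
  ring

theorem hasDerivAt_gradWeight (hA : 0 < A) (hB : 0 < B) (hS : 0 < S) {K : ℝ}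
    (hν : ν * ((2 - q) * A) = K) :
    HasDerivAt (gradWeight A B q ν a)
      (gradWeight A B q ν a S * (a - K * ε + K * gradMultiplier A B q ε S) / S) S := by
  have hD : 0 < B + A * S ^ (2 - q) := by positivity
  have h1 : HasDerivAt (fun t : ℝ => t ^ a) (a * S ^ (a - 1)) S :=
    Real.hasDerivAt_rpow_const (Or.inl hS.ne')
  have h2 : HasDerivAt (fun t : ℝ => B + A * t ^ (2 - q)) (A * ((2 - q) * S ^ (2 - q - 1))) S :=
    ((Real.hasDerivAt_rpow_const (Or.inl hS.ne')).const_mul A).const_add B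
  refine (h1.mul (h2.rpow_const (p := ν) (Or.inl hD.ne'))).congr_deriv ?_
  unfold gradWeight gradMultiplier
  rw [← hν, Real.rpow_sub_one hS.ne', Real.rpow_sub_one hS.ne', Real.rpow_sub_one hD.ne']
  field_simp
  ring

theorem hasDerivAt_gradMultiplier (hA : 0 < A) (hB : 0 < B) (hS : 0 < S) :
    HasDerivAt (gradMultiplier A B q ε)
      ((2 - q) * S ^ (q - 2) * B / (A + B * S ^ (q - 2)) ^ 2 / S) S := by
  have hD : 0 < B + A * S ^ (2 - q) := by positivity
  have h1 : HasDerivAt (fun t : ℝ => t ^ (2 - q)) ((2 - q) * S ^ (2 - q - 1)) S :=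
    Real.hasDerivAt_rpow_const (Or.inl hS.ne')
  refine ((h1.div ((h1.const_mul A).const_add B) hD.ne').const_add ε).congr_deriv ?_
  rw [Real.rpow_sub_one hS.ne', show q - 2 = -(2 - q) by ring, Real.rpow_neg hS.le]
  have : 0 < S ^ (2 - q) := by positivity
  field_simp
  ring

variable {n : ℕ} {v : EuclideanSpace ℝ (Fin n) → ℝ}

theorem contDiff_gradWeight (hv : ContDiff ℝ 2 v) (hA : 0 < A) (hB : 0 < B) (hq : q < 1)
    (ha : 1 < a) : ContDiff ℝ 1 (fun y => gradWeight A B q ν a ‖gradient v y‖) := by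
  unfold gradWeight
  refine (hv.gradient.norm_rpow ha).mul (ContDiff.rpow_const_of_ne ?_ fun y => ?_)
  · exact contDiff_const.add (contDiff_const.mul (hv.gradient.norm_rpow (by linarith)))
  · positivity

theorem contDiff_gradMultiplier (hv : ContDiff ℝ 2 v) (hA : 0 < A) (hB : 0 < B) (hq : q < 1) :
    ContDiff ℝ 1 (fun y => gradMultiplier A B q ε ‖gradient v y‖) := by
  unfold gradMultiplier
  have h : ContDiff ℝ 1 fun y => ‖gradient v y‖ ^ (2 - q) :=
    hv.gradient.norm_rpow (by linarith)
  refine contDiff_const.add (h.div (contDiff_const.add (contDiff_const.mul h)) fun y => ?_)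
  positivity

end Weights

section Absorption

theorem exists_weight_root_bound {A B q ε : ℝ} (hA : 0 < A) (hB : 0 < B) (hq : q < 1)
    (hε : 0 < ε) : ∃ C : ℝ, 0 < C ∧ ∀ S y : ℝ, 0 < S → 0 < y →
      S ^ ε * (B + A * S ^ (2 - q)) ^ (1 / ((2 - q) * A)) / y ≤
        C * (S * (1 + S ^ (q - 2)) / y +
          (S * (1 + S ^ (q - 2)) / y) ^ (ε + 1 / A) * y ^ (ε + 1 / A - 1)) := by
  have hq2 : 0 < 2 - q := by linarith
  refine ⟨(A + B) ^ (1 / ((2 - q) * A)), by positivity, fun S y hS hy => ?_⟩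
  set Z := S * (1 + S ^ (q - 2)) / y with hZ
  have hZ0 : 0 < Z := by positivity
  have hZy : Z * y = S + S ^ (q - 1) := by
    rw [hZ, div_mul_cancel₀ _ hy.ne', show q - 2 = q - 1 - 1 by ring, Real.rpow_sub_one hS.ne']
    field_simp
  rcases le_total S 1 with h | h
  · have h1 : S ^ ε * (B + A * S ^ (2 - q)) ^ (1 / ((2 - q) * A)) ≤
        1 * (A + B) ^ (1 / ((2 - q) * A)) := by
      have h2 : S ^ (2 - q) ≤ 1 := Real.rpow_le_one hS.le h hq2.le
      have h3 : B + A * S ^ (2 - q) ≤ A + B := by nlinarith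
      exact mul_le_mul (Real.rpow_le_one hS.le h hε.le)
        (Real.rpow_le_rpow (by positivity) h3 (by positivity)) (by positivity) zero_le_one
    have h2 : 1 / y ≤ Z := by
      rw [div_le_iff₀ hy, hZy]
      have : 1 ≤ S ^ (q - 1) := Real.one_le_rpow_of_pos_of_le_one_of_nonpos hS h (by linarith)
      linarith
    calc _ ≤ 1 * (A + B) ^ (1 / ((2 - q) * A)) / y := by gcongr
      _ = (A + B) ^ (1 / ((2 - q) * A)) * (1 / y) := by ring
      _ ≤ _ := by
        gcongr
        have : 0 ≤ Z ^ (ε + 1 / A) * y ^ (ε + 1 / A - 1) := by positivity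
        linarith
  · have h1 : S ^ ε * (B + A * S ^ (2 - q)) ^ (1 / ((2 - q) * A)) ≤
        (A + B) ^ (1 / ((2 - q) * A)) * S ^ (ε + 1 / A) := by
      have h2 : 1 ≤ S ^ (2 - q) := Real.one_le_rpow h hq2.le
      calc _ ≤ S ^ ε * ((A + B) * S ^ (2 - q)) ^ (1 / ((2 - q) * A)) := by
            gcongr
            nlinarith
        _ = _ := by
            rw [Real.mul_rpow (by positivity) (by positivity), ← Real.rpow_mul hS.le,
              Real.rpow_add hS, show (2 - q) * (1 / ((2 - q) * A)) = 1 / A by field_simp]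
            ring
    have h2 : S ≤ Z * y := by
      rw [hZy]
      have : 0 < S ^ (q - 1) := by positivity
      linarith
    calc _ ≤ (A + B) ^ (1 / ((2 - q) * A)) * S ^ (ε + 1 / A) / y := by gcongr
      _ ≤ (A + B) ^ (1 / ((2 - q) * A)) * (Z * y) ^ (ε + 1 / A) / y := by gcongr
      _ = (A + B) ^ (1 / ((2 - q) * A)) * (Z ^ (ε + 1 / A) * y ^ (ε + 1 / A - 1)) := by
          rw [Real.mul_rpow hZ0.le hy.le, Real.rpow_sub_one hy.ne']
          ring
      _ ≤ _ := by
        gcongr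
        linarith

theorem gradWeight_mul_rpow_eq {A B q ε K S y : ℝ} (hA : 0 < A) (hB : 0 < B) (hS : 0 < S)
    (hy : 0 < y) : y ^ (-K) * gradWeight A B q (K / ((2 - q) * A)) (K * ε) S =
      (S ^ ε * (B + A * S ^ (2 - q)) ^ (1 / ((2 - q) * A)) / y) ^ K := by
  have : 0 < B + A * S ^ (2 - q) := by positivity
  unfold gradWeight
  rw [Real.div_rpow (by positivity) hy.le, Real.mul_rpow (by positivity) (by positivity),
    ← Real.rpow_mul hS.le, ← Real.rpow_mul this.le, Real.rpow_neg hy.le]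
  ring_nf

theorem absorb_cutoff_gradient {η G Z y R E c C D K L M κ : ℝ} (hη0 : 0 < η) (hη1 : η ≤ 1)
    (hG : 0 ≤ G) (hZ : 0 ≤ Z) (hy : 0 < y) (hR : 1 ≤ R) (hE : 0 < E) (hc : 0 < c) (hC : 0 < C)
    (hD : 0 < D) (hK : 0 < K) (hM : 1 ≤ M) (hGZ : G ≤ C * (Z + Z ^ M * y ^ (M - 1)))
    (hyR : y ≤ D * R ^ L) (hκ1 : κ ≤ 1) (hκ2 : κ ≤ M - L * (M - 1)) {e : ℕ} (he : K * M ≤ e) :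
    E * η ^ e * G ^ K / R ^ 2 ≤ c / 2 * η ^ (e + 2) * G ^ K * Z ^ 2 +
      E * (C * (√(2 * E / c) + √(2 * E / c) ^ M * D ^ (M - 1))) ^ K * R ^ (-(K * κ)) := by
  have hR0 : 0 < R := by linarith
  set Λ := √(2 * E / c) with hΛ
  have hΛ0 : 0 < Λ := by positivity
  have hΛ2 : Λ ^ 2 = 2 * E / c := Real.sq_sqrt (by positivity)
  rcases le_total Λ (η * R * Z) with h | h
  · have h1 : E ≤ c / 2 * (η * R * Z) ^ 2 := by
      have : Λ ^ 2 ≤ (η * R * Z) ^ 2 := by gcongr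
      rw [hΛ2, div_le_iff₀ hc] at this
      linarith
    have h2 : E * η ^ e * G ^ K / R ^ 2 ≤ c / 2 * η ^ (e + 2) * G ^ K * Z ^ 2 := by
      rw [div_le_iff₀ (by positivity)]
      calc E * η ^ e * G ^ K = E * (η ^ e * G ^ K) := by ring
        _ ≤ c / 2 * (η * R * Z) ^ 2 * (η ^ e * G ^ K) := by gcongr
        _ = _ := by ring
    have h3 : 0 ≤ E * (C * (Λ + Λ ^ M * D ^ (M - 1))) ^ K * R ^ (-(K * κ)) := by positivity
    linarith
  · have h1 : η * Z ≤ Λ / R := by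
      rw [le_div_iff₀ hR0]
      linarith
    have hηM : η ^ M ≤ η := by
      simpa using Real.rpow_le_rpow_of_exponent_ge hη0 hη1 hM
    have hyM : y ^ (M - 1) ≤ D ^ (M - 1) * R ^ (L * (M - 1)) := by
      rw [Real.rpow_mul hR0.le, ← Real.mul_rpow hD.le (by positivity)]
      exact Real.rpow_le_rpow hy.le hyR (by linarith)
    have h2 : η ^ M * G ≤ C * (Λ + Λ ^ M * D ^ (M - 1)) * R ^ (-κ) := by
      have a1 : Λ / R ≤ Λ * R ^ (-κ) := by
        rw [div_eq_mul_inv, ← Real.rpow_neg_one]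
        gcongr
      have a2 : (Λ / R) ^ M * (D ^ (M - 1) * R ^ (L * (M - 1))) ≤
          Λ ^ M * D ^ (M - 1) * R ^ (-κ) := by
        calc _ = Λ ^ M * D ^ (M - 1) * R ^ (-M + L * (M - 1)) := by
              rw [Real.div_rpow hΛ0.le hR0.le, Real.rpow_add hR0, Real.rpow_neg hR0.le]
              ring
          _ ≤ _ := by
              gcongr
              linarith
      calc η ^ M * G ≤ η ^ M * (C * (Z + Z ^ M * y ^ (M - 1))) := by gcongr
        _ = C * (η ^ M * Z + (η * Z) ^ M * y ^ (M - 1)) := by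
            rw [Real.mul_rpow hη0.le hZ]
            ring
        _ ≤ C * (Λ / R + (Λ / R) ^ M * (D ^ (M - 1) * R ^ (L * (M - 1)))) := by
            gcongr
            exact (mul_le_mul_of_nonneg_right hηM hZ).trans h1
        _ ≤ C * (Λ * R ^ (-κ) + Λ ^ M * D ^ (M - 1) * R ^ (-κ)) := by gcongr
        _ = _ := by ring
    have h3 : η ^ e * G ^ K ≤
        (C * (Λ + Λ ^ M * D ^ (M - 1))) ^ K * R ^ (-(K * κ)) := by
      calc η ^ e * G ^ K ≤ η ^ (M * K) * G ^ K := by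
            gcongr
            rw [← Real.rpow_natCast]
            exact Real.rpow_le_rpow_of_exponent_ge hη0 hη1 (by linarith)
        _ = (η ^ M * G) ^ K := by
            rw [Real.mul_rpow (by positivity) hG, ← Real.rpow_mul hη0.le]
        _ ≤ (C * (Λ + Λ ^ M * D ^ (M - 1)) * R ^ (-κ)) ^ K := by gcongr
        _ = _ := by
            rw [Real.mul_rpow (by positivity) (by positivity), ← Real.rpow_mul hR0.le]
            ring_nf
    have h4 : 0 ≤ c / 2 * η ^ (e + 2) * G ^ K * Z ^ 2 := by positivity
    calc E * η ^ e * G ^ K / R ^ 2 ≤ E * η ^ e * G ^ K := by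
          refine div_le_self (by positivity) ?_
          exact one_le_pow₀ hR
      _ = E * (η ^ e * G ^ K) := by ring
      _ ≤ E * ((C * (Λ + Λ ^ M * D ^ (M - 1))) ^ K * R ^ (-(K * κ))) := by gcongr
      _ ≤ _ := by linarith

end Absorption

section Coercive

variable {n : ℕ} {v : EuclideanSpace ℝ (Fin n) → ℝ}

/-- The integral estimate with the cutoff `η`, before absorbing the gradient of the cutoff. -/
theorem exists_bochner_cutoff_integral (hn : 3 ≤ n) {A B q ε c k K : ℝ} (hq0 : 0 ≤ q)
    (hq1 : q < 1) (hA : 0 < A) (hB : 0 < B) (hε : 0 < ε) (hK : 1 ≤ K)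
    (hKε : 3 < K * ε)
    (hstar : ∀ ξ : ℝ, 0 < ξ → ∀ β : ℝ, c * (1 + ξ) ^ 2 ≤
      (ε + 1 / (A + B * ξ)) * ((1 + k + ξ - β) ^ 2 / ((n : ℝ) - 1) - β ^ 2 +
        (2 * (1 + k) + q * ξ) * β - (1 + k + ξ)) +
      (2 - q) * ξ * B / (A + B * ξ) ^ 2 * β ^ 2 - (1 + k + ξ) + 1 +
      (K - 1) * ((ε + 1 / (A + B * ξ)) * β - 1) ^ 2)
    (hk : 0 < k) (hv : ContDiff ℝ 2 v) (hpos : ∀ x, 0 < v x)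
    (heq : ∀ x, elaplacian v x = ((1 + k) * ‖gradient v x‖ ^ 2 + ‖gradient v x‖ ^ q) / v x)
    {η : EuclideanSpace ℝ (Fin n) → ℝ} (hη : ContDiff ℝ 1 η) (hηc : HasCompactSupport η)
    (hη0 : ∀ x, 0 ≤ η x) (e : ℕ) :
    ∃ I : EuclideanSpace ℝ (Fin n) → ℝ, Integrable I ∧ ∫ x, I x = 0 ∧
      (∀ x, gradient v x = 0 → I x = 0) ∧ ∀ x, gradient v x ≠ 0 →
        v x ^ (-K) * gradWeight A B q (K / ((2 - q) * A)) (K * ε) ‖gradient v x‖ *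
          (c * η x ^ (e + 2) *
              (‖gradient v x‖ * (1 + ‖gradient v x‖ ^ (q - 2)) / v x) ^ 2 -
            ((e : ℝ) + 2) ^ 2 / 4 * η x ^ e * ∑ i, partialD i η x ^ 2) ≤ I x := by
  have hq2 : 0 < 2 - q := by linarith
  set ν := K / ((2 - q) * A) with hν
  have hνK : ν * ((2 - q) * A) = K := by rw [hν]; field_simp
  set m : ℝ → ℝ := gradMultiplier A B q ε with hm
  set W : ℝ → ℝ → ℝ := gradWeight A B q ν with hW
  set th : ℝ → ℝ := fun S => W (K * ε - 2) S * m S with hth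
  set ps : ℝ → ℝ := fun S => ((1 + k) * W (K * ε) S + W (K * ε - 2 + q) S) * m S with hps
  have hW0 : ∀ a y, 0 ≤ W a ‖gradient v y‖ := fun a y => gradWeight_nonneg hA hB (norm_nonneg _)
  have hm0 : ∀ y, 0 < m ‖gradient v y‖ := fun y => gradMultiplier_pos hA hB hε (norm_nonneg _)
  have hWc : ∀ a, 1 < a → ContDiff ℝ 1 (fun y => W a ‖gradient v y‖) := fun a ha =>
    contDiff_gradWeight hv hA hB hq1 ha
  have hmc : ContDiff ℝ 1 (fun y => m ‖gradient v y‖) := contDiff_gradMultiplier hv hA hB hq1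
  have hvc : ∀ a : ℝ, ContDiff ℝ 1 (fun y => v y ^ a) := fun a =>
    (hv.of_le (by norm_num)).rpow_const_of_ne fun y => (hpos y).ne'
  have hthc : ContDiff ℝ 1 (fun y => th ‖gradient v y‖) := (hWc _ (by linarith)).mul hmc
  have hpsc : ContDiff ℝ 1 (fun y => ps ‖gradient v y‖) :=
    ((contDiff_const.mul (hWc _ (by linarith))).add (hWc _ (by linarith))).mul hmc
  have hηp : HasCompactSupport (fun y => η y ^ (e + 2)) :=
    hηc.comp_left (g := fun t : ℝ => t ^ (e + 2)) (by simp)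
  have hφ : ContDiff ℝ 1 (fun y => η y ^ (e + 2) * (v y ^ (-K) * th ‖gradient v y‖)) :=
    (hη.pow _).mul ((hvc _).mul hthc)
  have hχ : ContDiff ℝ 1 (fun y => η y ^ (e + 2) * (v y ^ (-K - 1) * ps ‖gradient v y‖)) :=
    (hη.pow _).mul ((hvc _).mul hpsc)
  have hζ : ContDiff ℝ 1
      (fun y => η y ^ (e + 2) * (v y ^ (-K - 1) * W (K * ε) ‖gradient v y‖)) :=
    (hη.pow _).mul ((hvc _).mul (hWc _ (by linarith)))
  have hχφ : ∀ y, η y ^ (e + 2) * (v y ^ (-K - 1) * ps ‖gradient v y‖) =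
      η y ^ (e + 2) * (v y ^ (-K) * th ‖gradient v y‖) * elaplacian v y := fun y => by
    have hvy := hpos y
    rw [heq, Real.rpow_sub_one hvy.ne']
    simp only [hth, hps]
    rcases (norm_nonneg (gradient v y)).eq_or_lt with h | h
    · rw [← h, hW, gradWeight_zero (by linarith), gradWeight_zero (by linarith),
        gradWeight_zero (by linarith)]
      ring
    · rw [hW, gradWeight_add h q,
        show K * ε = K * ε - 2 + ((2 : ℕ) : ℝ) by push_cast; ring, gradWeight_add h,
        Real.rpow_natCast]
      push_cast
      rw [add_sub_cancel_right]
      ring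
  obtain ⟨hi1, hi10⟩ := integral_bochner hv hφ hηp.mul_right hχ hηp.mul_right hχφ
  obtain ⟨hi2, hi20⟩ := integral_div_mul_grad hv hζ hηp.mul_right
  refine ⟨_, hi1.sub hi2, ?_, fun x hx => ?_, fun x hx => ?_⟩
  · simp only [Pi.sub_apply]
    rw [integral_sub hi1 hi2, hi10, hi20, sub_zero]
  · have hx' : ‖gradient v x‖ = 0 := by rw [hx, norm_zero]
    have hWx : ∀ a, a ≠ 0 → W a ‖gradient v x‖ = 0 := fun a ha => by
      rw [hx', hW, gradWeight_zero ha]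
    have hthx : th ‖gradient v x‖ = 0 := by
      simp only [hth, hWx (K * ε - 2) (by linarith), zero_mul]
    have hpsx : ps ‖gradient v x‖ = 0 := by
      simp only [hps, hWx (K * ε - 2 + q) (by linarith), hWx (K * ε) (by linarith)]
      ring
    have hWx0 := hWx (K * ε) (by linarith)
    have h1 := fun j => partialD_eq_zero_of_nonneg (x := x)
      (f := fun y => η y ^ (e + 2) * (v y ^ (-K) * th ‖gradient v y‖)) (fun y => by
        have := hη0 y
        have := hpos y
        have := hW0 (K * ε - 2) y
        have := hm0 y
        simp only [hth]
        positivity) (by simp only [hthx, mul_zero]) j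
    have h2 := fun j => partialD_eq_zero_of_nonneg (x := x)
      (f := fun y => η y ^ (e + 2) * (v y ^ (-K - 1) * ps ‖gradient v y‖)) (fun y => by
        have := hη0 y
        have := hpos y
        have := hW0 (K * ε) y
        have := hW0 (K * ε - 2 + q) y
        have := hm0 y
        simp only [hps]
        positivity) (by simp only [hpsx, mul_zero]) j
    have h3 := fun j => partialD_eq_zero_of_nonneg (x := x)
      (f := fun y => η y ^ (e + 2) * (v y ^ (-K - 1) * W (K * ε) ‖gradient v y‖)) (fun y => by
        have := hη0 y
        have := hpos y
        have := hW0 (K * ε) y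
        positivity) (by simp only [hWx0, mul_zero]) j
    simp only [Pi.sub_apply, h1, h2, h3, hthx, hWx0, mul_zero, zero_mul, Finset.sum_const_zero,
      add_zero, sub_zero]
  · have hS : 0 < ‖gradient v x‖ := norm_pos_iff.mpr hx
    have hvx := hpos x
    set S := ‖gradient v x‖ with hSdef
    set ξ := S ^ (q - 2) with hξ
    have hξ0 : 0 < ξ := Real.rpow_pos_of_pos hS _
    have hmS : m S = ε + 1 / (A + B * ξ) := gradMultiplier_eq hA hB hS
    have hWt : W (K * ε - 2) S = W (K * ε) S / S ^ 2 := by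
      rw [eq_div_iff (by positivity), hW, ← Real.rpow_natCast, ← gradWeight_add hS]
      push_cast
      rw [sub_add_cancel]
    have hWp : W (K * ε - 2 + q) S = W (K * ε) S * ξ := by
      rw [hξ, hW, ← gradWeight_add hS]
      ring_nf
    have hdW : ∀ a, HasDerivAt (W a) (W a S * (a - K * ε + K * m S) / S) S := fun a =>
      hasDerivAt_gradWeight hA hB hS hνK
    have hdm : HasDerivAt m ((2 - q) * ξ * B / (A + B * ξ) ^ 2 / S) S :=
      hasDerivAt_gradMultiplier hA hB hS
    refine bochner_integrand_lower_bound hv (by omega) hvx (hη.differentiable (by norm_num) x)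
      (hη0 x) e (m := m S) (ρ := (2 - q) * ξ * B / (A + B * ξ) ^ 2) (φ := 1 + k + ξ)
      (ψ := 2 * (1 + k) + q * ξ) (th := th) (ps := ps) (jj := W (K * ε)) hS hSdef.symm (hm0 x)
      (by positivity) hK (hW0 _ x) ?_ ?_ rfl ?_ ?_ ?_ ?_ ?_
    · rw [heq, ← hSdef, hξ, Real.rpow_sub hS, show (2 : ℝ) = ((2 : ℕ) : ℝ) by norm_num,
        Real.rpow_natCast]
      field_simp
    · rw [hmS]
      exact hstar ξ hξ0
    · simp only [hth, hWt]
      ring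
    · simp only [hps, hWp]
      ring
    · refine (hdW _).congr_deriv ?_
      ring
    · refine ((hdW (K * ε - 2)).mul hdm).congr_deriv ?_
      rw [hWt]
      field_simp
      ring
    · refine ((((hdW (K * ε)).const_mul (1 + k)).add (hdW (K * ε - 2 + q))).mul hdm).congr_deriv ?_
      simp only [Pi.add_apply]
      rw [hWp]
      field_simp
      ring

end Coercive

section Liouville

variable {n : ℕ}

theorem gradient_eq_zero_of_transformed_equation (hn : 3 ≤ n) {q k : ℝ} (hq0 : 0 ≤ q)
    (hq1 : q < 1) (hnq : 1 ≤ ((n : ℝ) - 1) * (1 - q) ^ 2) (hk0 : 0 < k)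
    (hk : ((n : ℝ) - 2) * (1 - q) < k * (2 - q)) (hkn : k ≤ (n : ℝ) - 2)
    {v : EuclideanSpace ℝ (Fin n) → ℝ} (hv : ContDiff ℝ 2 v) (hpos : ∀ x, 0 < v x)
    (heq : ∀ x, elaplacian v x = ((1 + k) * ‖gradient v x‖ ^ 2 + ‖gradient v x‖ ^ q) / v x)
    (hgrowth : ∀ a : ℝ, (n : ℝ) - 2 < a → ∃ D : ℝ, 0 < D ∧ ∀ R : ℝ, 1 ≤ R →
      ∀ x ∈ Metric.ball (0 : EuclideanSpace ℝ (Fin n)) (2 * R), v x ≤ D * R ^ (a / k)) (x) :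
    gradient v x = 0 := by
  have hn' : (3 : ℝ) ≤ n := by exact_mod_cast hn
  obtain ⟨A, B, ε, c, K₀, hA, hA1, hB, hε, hc, hK₀, hMk, hstar⟩ :=
    exists_coercive_parameters (N := (n : ℝ) - 1) (k := k) (by linarith) hq0 hq1 hnq
      (by linarith) (by linarith)
  have hM : 1 < ε + 1 / A := by
    have : 1 < 1 / A := by rwa [lt_div_iff₀ hA, one_mul]
    linarith
  set M := ε + 1 / A with hMdef
  have hM' : 0 < 1 - 1 / M := by
    rw [sub_pos, div_lt_one (by linarith)]
    exact hM
  obtain ⟨a, ha1, ha2⟩ := exists_between (show (n : ℝ) - 2 < k / (1 - 1 / M) by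
    rw [lt_div_iff₀ hM']
    linarith)
  rw [lt_div_iff₀ hM'] at ha2
  obtain ⟨D, hD, hDv⟩ := hgrowth a ha1
  set L := a / k with hL
  have hκ' : 0 < M - L * (M - 1) := by
    have h1 : M - L * (M - 1) = M * (k - a * (1 - 1 / M)) / k := by
      rw [hL]
      field_simp
    rw [h1]
    exact div_pos (mul_pos (by linarith) (by linarith)) hk0
  set κ := min 1 (M - L * (M - 1)) with hκ
  have hκ0 : 0 < κ := lt_min one_pos hκ'
  set K := 1 + K₀ + 4 / ε + (n + 1) / κ with hK
  have h4ε : 0 < 4 / ε := by positivity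
  have hnκ : 0 < (n + 1) / κ := by positivity
  have hKε : 3 < K * ε := by
    have : 4 / ε * ε ≤ K * ε := by gcongr; linarith
    rw [div_mul_cancel₀ _ hε.ne'] at this
    linarith
  have hKκ : (n : ℝ) < K * κ := by
    have : (n + 1) / κ * κ ≤ K * κ := by gcongr; linarith
    rw [div_mul_cancel₀ _ hκ0.ne'] at this
    linarith
  have hK1 : 1 ≤ K := by linarith
  obtain ⟨C₁, hC₁, hroot⟩ := exists_weight_root_bound hA hB hq1 hε
  obtain ⟨C, hC, hcut⟩ := exists_cutoff n
  obtain ⟨e, he⟩ := exists_nat_ge (K * M)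
  have he0 : e ≠ 0 := by
    rintro rfl
    have : 0 < K * M := by positivity
    norm_num at he
    linarith
  set E := ((e : ℝ) + 2) ^ 2 / 4 * C with hE
  have hE0 : 0 < E := by positivity
  set ν := K / ((2 - q) * A) with hν
  set C₂ := E * (C₁ * (√(2 * E / c) + √(2 * E / c) ^ M * D ^ (M - 1))) ^ K with hC₂
  have hC₂0 : 0 < C₂ := by positivity
  set f : EuclideanSpace ℝ (Fin n) → ℝ := fun x => v x ^ (-K - 2) *
    gradWeight A B q ν (K * ε - 2) ‖gradient v x‖ *
      (‖gradient v x‖ ^ 2 + ‖gradient v x‖ ^ q) ^ 2 with hf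
  have hgc : Continuous fun x => ‖gradient v x‖ := hv.gradient.continuous.norm
  have hfc : Continuous f := by
    have h1 : Continuous fun x => ‖gradient v x‖ ^ q := hgc.rpow_const fun x => Or.inr hq0
    have h2 : Continuous fun x => gradWeight A B q ν (K * ε - 2) ‖gradient v x‖ :=
      (contDiff_gradWeight hv hA hB hq1 (by linarith)).continuous
    have h3 : Continuous fun x => v x ^ (-K - 2) :=
      hv.continuous.rpow_const fun x => Or.inl (hpos x).ne'
    fun_prop
  have hf0 : ∀ x, 0 ≤ f x := fun x => by
    have h1 : 0 ≤ gradWeight A B q ν (K * ε - 2) ‖gradient v x‖ :=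
      gradWeight_nonneg hA hB (norm_nonneg _)
    have := hpos x
    simp only [hf]
    positivity
  have hfx : ∀ x, gradient v x ≠ 0 → f x =
      v x ^ (-K) * gradWeight A B q ν (K * ε) ‖gradient v x‖ *
        (‖gradient v x‖ * (1 + ‖gradient v x‖ ^ (q - 2)) / v x) ^ 2 := fun x hx => by
    have hS : 0 < ‖gradient v x‖ := norm_pos_iff.mpr hx
    have hvx := hpos x
    have h1 : ‖gradient v x‖ ^ q = ‖gradient v x‖ ^ (q - 2) * ‖gradient v x‖ ^ 2 := by
      rw [← Real.rpow_natCast, ← Real.rpow_add hS]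
      norm_num
    have h2 : v x ^ (-K) = v x ^ (-K - 2) * v x ^ 2 := by
      rw [← Real.rpow_natCast, ← Real.rpow_add hvx]
      norm_num
    have h3 : gradWeight A B q ν (K * ε) ‖gradient v x‖ =
        gradWeight A B q ν (K * ε - 2) ‖gradient v x‖ * ‖gradient v x‖ ^ 2 := by
      rw [← Real.rpow_natCast, ← gradWeight_add hS]
      norm_num
    simp only [hf]
    rw [h1, h2, h3]
    field_simp
  have key := eq_zero_of_integral_bound (C := 2 / c * C₂) hfc hf0 hKκ ?_ x
  · by_contra hx
    have hS : 0 < ‖gradient v x‖ := norm_pos_iff.mpr hx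
    have hvx := hpos x
    have hW : 0 < gradWeight A B q ν (K * ε - 2) ‖gradient v x‖ := gradWeight_pos hA hB hS
    have : 0 < f x := by
      simp only [hf]
      positivity
    exact this.ne' key
  intro R hR
  have hR0 : 0 < R := by linarith
  obtain ⟨η, hη, hηc, hη0, hη1, hηb, hηo, hηg⟩ := hcut R hR0
  obtain ⟨I, hi, hi0, hI0, hI⟩ := exists_bochner_cutoff_integral hn hq0 hq1 hA hB hε hK1 hKε
    (c := c) (fun ξ hξ β => (hstar ξ hξ β).trans (by gcongr; linarith)) hk0 hv hpos heq hη hηc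
    hη0 e
  refine ⟨_, hi.const_mul (2 / c), by rw [integral_const_mul, hi0, mul_zero], fun x => ?_⟩
  have hind : 0 ≤ (Metric.ball (0 : EuclideanSpace ℝ (Fin n)) (2 * R)).indicator
      (fun _ => 2 / c * C₂ * R ^ (-(K * κ))) x :=
    indicator_nonneg (fun _ _ => by positivity) x
  have h5 : (Metric.ball 0 R).indicator f x ≤ η x ^ (e + 2) * f x := by
    by_cases hxR : x ∈ Metric.ball 0 R
    · rw [indicator_of_mem hxR, hηb x hxR, one_pow, one_mul]
    · rw [indicator_of_notMem hxR]
      exact mul_nonneg (pow_nonneg (hη0 x) _) (hf0 x)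
  refine h5.trans ?_
  by_cases hx : gradient v x = 0
  · have : f x = 0 := by
      simp only [hf, hx, norm_zero]
      rw [gradWeight_zero (by linarith), mul_zero, zero_mul]
    rw [this, hI0 x hx, mul_zero, mul_zero, zero_add]
    exact hind
  have hIx := hI x hx
  rcases (hη0 x).eq_or_lt with h0 | h0
  · rw [← h0, zero_pow he0, zero_pow (by omega)] at hIx
    simp only [mul_zero, zero_mul, sub_zero] at hIx
    rw [← h0, zero_pow (by omega), zero_mul]
    have : 0 ≤ 2 / c * I x := mul_nonneg (by positivity) hIx
    linarith
  have hxb : x ∈ Metric.ball 0 (2 * R) := by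
    by_contra h
    exact h0.ne' (hηo x h)
  have hS : 0 < ‖gradient v x‖ := norm_pos_iff.mpr hx
  have hvx := hpos x
  have hG : 0 ≤ ‖gradient v x‖ ^ ε *
      (B + A * ‖gradient v x‖ ^ (2 - q)) ^ (1 / ((2 - q) * A)) / v x := by positivity
  have hZ : 0 ≤ ‖gradient v x‖ * (1 + ‖gradient v x‖ ^ (q - 2)) / v x := by positivity
  have habs := absorb_cutoff_gradient h0 (hη1 x) hG hZ hvx hR hE0 hc hC₁ hD (by linarith)
    hM.le (hroot _ _ hS hvx) (hDv R hR x hxb) (min_le_left _ _) (min_le_right _ _) he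
  rw [indicator_of_mem hxb]
  have hfx' := hfx x hx
  rw [gradWeight_mul_rpow_eq hA hB hS hvx] at hIx hfx'
  rw [hfx']
  set G := ‖gradient v x‖ ^ ε *
      (B + A * ‖gradient v x‖ ^ (2 - q)) ^ (1 / ((2 - q) * A)) / v x with hGdef
  set Z := ‖gradient v x‖ * (1 + ‖gradient v x‖ ^ (q - 2)) / v x with hZdef
  have h6 : G ^ K * (((e : ℝ) + 2) ^ 2 / 4 * η x ^ e * ∑ i, partialD i η x ^ 2) ≤
      E * η x ^ e * G ^ K / R ^ 2 := by
    calc _ ≤ G ^ K * (((e : ℝ) + 2) ^ 2 / 4 * η x ^ e * (C / R ^ 2)) := by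
          gcongr
          exact hηg x
      _ = _ := by rw [hE]; ring
  have h7 : c / 2 * (η x ^ (e + 2) * (G ^ K * Z ^ 2)) ≤ I x + C₂ * R ^ (-(K * κ)) := by
    linarith
  have h8 := mul_le_mul_of_nonneg_left h7 (show 0 ≤ 2 / c by positivity)
  have h9 : 2 / c * (c / 2 * (η x ^ (e + 2) * (G ^ K * Z ^ 2))) =
      η x ^ (e + 2) * (G ^ K * Z ^ 2) := by field_simp
  linarith

end Liouville

end Auxiliary

/-- **Theorem 1.1, case (3).** For `n ≥ 3`, `0 ≤ q ≤ 1 − 1/√(n−1)` and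
`p + q − 1 < (2−q)²/((1−q)(n−2))`, every positive classical solution of
`Δu + |∇u|^q u^p = 0` on all of `ℝⁿ` is constant. -/
theorem liouville_small_q_subcritical (n : ℕ) (hn : 3 ≤ n) (p q : ℝ)
    (hq0 : 0 ≤ q) (hq1 : q ≤ 1 - 1 / Real.sqrt ((n : ℝ) - 1))
    (hsub : p + q - 1 < (2 - q) ^ 2 / ((1 - q) * ((n : ℝ) - 2)))
    (u : EuclideanSpace ℝ (Fin n) → ℝ)
    (hu : ContDiff ℝ 2 u)
    (hpos : ∀ x, 0 < u x)
    (heq : ∀ x, elaplacian u x + ‖gradient u x‖ ^ q * u x ^ p = 0) :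
    ∀ x y, u x = u y := by
  have hn' : (3 : ℝ) ≤ n := by exact_mod_cast hn
  have hs : 0 < √((n : ℝ) - 1) := Real.sqrt_pos.mpr (by linarith)
  have hs1 : 0 < 1 / √((n : ℝ) - 1) := by positivity
  have hq : q < 1 := by linarith
  have hnq : 1 ≤ ((n : ℝ) - 1) * (1 - q) ^ 2 := by
    have h1 : (1 / √((n : ℝ) - 1)) ^ 2 ≤ (1 - q) ^ 2 := by gcongr; linarith
    rw [div_pow, one_pow, Real.sq_sqrt (by linarith), div_le_iff₀ (by linarith)] at h1
    linarith
  refine eq_of_gradient_eq_zero hu fun x => ?_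
  rcases lt_or_ge (((n : ℝ) - 2) * (q + 2 * p)) (n * (2 - q)) with h | h
  · exact gradient_eq_zero_of_small_exponent hn hq0 hq h hu hpos heq x
  · have hn2 : 0 < (n : ℝ) - 2 := by linarith
    have hσ : 2 - q ≤ ((n : ℝ) - 2) * (p + q - 1) := by nlinarith
    have hσ0 : 0 < p + q - 1 := by
      by_contra hneg
      nlinarith
    have hkσ : (2 - q) / (p + q - 1) * (p + q - 1) = 2 - q := div_mul_cancel₀ _ hσ0.ne'
    have hk0 : 0 < (2 - q) / (p + q - 1) := div_pos (by linarith) hσ0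
    obtain ⟨v, hv, hvpos, hveq, hvgrowth, hvu⟩ :=
      exists_power_transform hn hq hk0 hkσ hu hpos heq
    refine hvu x (gradient_eq_zero_of_transformed_equation hn hq0 hq hnq hk0 ?_ ?_ hv hvpos hveq
      hvgrowth x)
    · rw [lt_div_iff₀ (by nlinarith)] at hsub
      rw [div_mul_eq_mul_div, lt_div_iff₀ hσ0]
      nlinarith
    · rw [div_le_iff₀ hσ0]
      exact hσ
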